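/- arXiv:1908.06679 — 5 statements merged into one kernel-verified Lean document; each statement's English description precedes it below -/
import Mathlib

section
/- For every n ≥ 3, J'³(n) + (n+1)·([0, n−3] ∪ {n}) + (2n+1)·([1, n−2] ∪ {n+1}) ⊆ J''³(2n+1). -/
/-- A Steiner triple system of order `v`: a collection of 3-element subsets of a
`v`-point set such that every 2-element subset lies in exactly one triple. -/
def IsSTS (v : ℕ) (B : Finset (Finset (Fin v))) : Prop :=
  (∀ b ∈ B, b.card = 3) ∧
  ∀ p : Finset (Fin v), p.card = 2 → ∃! b, b ∈ B ∧ p ⊆ b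

/-- The flower at a point `x`: the set of all triples containing `x`. -/
def flowerAt {v : ℕ} (B : Finset (Finset (Fin v))) (x : Fin v) : Finset (Finset (Fin v)) :=
  B.filter fun b => x ∈ b

/-- `J3F r`: the set of all `k` for which there exist three `STS(2r+1)`'s on a common
point set such that each pair of them intersects in the same set of `k + r` triples,
`r` of which form the flower at a common point. -/
def J3F (r : ℕ) : Set ℕ :=
  {k | ∃ (B₁ B₂ B₃ : Finset (Finset (Fin (2 * r + 1)))) (x : Fin (2 * r + 1)),
    IsSTS (2 * r + 1) B₁ ∧ IsSTS (2 * r + 1) B₂ ∧ IsSTS (2 * r + 1) B₃ ∧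
    B₁ ∩ B₂ = B₁ ∩ B₃ ∧ B₁ ∩ B₂ = B₂ ∩ B₃ ∧
    (B₁ ∩ B₂).card = k + r ∧
    flowerAt B₁ x = flowerAt B₂ x ∧ flowerAt B₁ x = flowerAt B₃ x ∧
    (flowerAt B₁ x).card = r}

/-- `J3 v`: the set of all `k` for which there exist three `STS(v)`'s on a common point
set pairwise intersecting in the same set of `k` triples. -/
def J3 (v : ℕ) : Set ℕ :=
  {k | ∃ (B₁ B₂ B₃ : Finset (Finset (Fin v))),
    IsSTS v B₁ ∧ IsSTS v B₂ ∧ IsSTS v B₃ ∧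
    B₁ ∩ B₂ = B₁ ∩ B₃ ∧ B₁ ∩ B₂ = B₂ ∩ B₃ ∧ (B₁ ∩ B₂).card = k}

/-- `JF r`: the set of all `k` for which there exist two `STS(2r+1)`'s on a common
point set having exactly `k + r` triples in common, `r` of them forming a common flower. -/
def JF (r : ℕ) : Set ℕ :=
  {k | ∃ (B₁ B₂ : Finset (Finset (Fin (2 * r + 1)))) (x : Fin (2 * r + 1)),
    IsSTS (2 * r + 1) B₁ ∧ IsSTS (2 * r + 1) B₂ ∧
    (B₁ ∩ B₂).card = k + r ∧
    flowerAt B₁ x = flowerAt B₂ x ∧ (flowerAt B₁ x).card = r}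

/-- `S3 m`: the nonnegative integers at most `m`, with the exception of
`m-1, m-2, m-3, m-4, m-5, m-7`. -/
def S3 (m : ℕ) : Set ℕ :=
  {k | k ≤ m ∧ k + 1 ≠ m ∧ k + 2 ≠ m ∧ k + 3 ≠ m ∧ k + 4 ≠ m ∧ k + 5 ≠ m ∧ k + 7 ≠ m}

/-- `I3F r = S3 (2r(r-1)/3)`. -/
def I3F (r : ℕ) : Set ℕ := S3 (2 * r * (r - 1) / 3)

/-- A Latin square of order `n` as a function: each row and each column is injective
(hence a permutation of the `n` symbols). -/
def IsLatin (n : ℕ) (L : Fin n → Fin n → Fin n) : Prop :=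
  (∀ i, Function.Injective (L i)) ∧ (∀ j, Function.Injective fun i => L i j)

/-- The cells where three squares all have identical entries. -/
def agreeCells (n : ℕ) (L₁ L₂ L₃ : Fin n → Fin n → Fin n) : Finset (Fin n × Fin n) :=
  Finset.univ.filter fun p => L₁ p.1 p.2 = L₂ p.1 p.2 ∧ L₂ p.1 p.2 = L₃ p.1 p.2

/-- `J3L n` (written `J'³(n)`): the set of `k` for which there exist three Latin squares
of order `n` with exactly `k` cells where all three have identical entries and all other
cells containing pairwise distinct entries in the three squares. -/
def J3L (n : ℕ) : Set ℕ :=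
  {k | ∃ L₁ L₂ L₃ : Fin n → Fin n → Fin n,
    IsLatin n L₁ ∧ IsLatin n L₂ ∧ IsLatin n L₃ ∧
    (agreeCells n L₁ L₂ L₃).card = k ∧
    ∀ p : Fin n × Fin n, p ∉ agreeCells n L₁ L₂ L₃ →
      L₁ p.1 p.2 ≠ L₂ p.1 p.2 ∧ L₁ p.1 p.2 ≠ L₃ p.1 p.2 ∧ L₂ p.1 p.2 ≠ L₃ p.1 p.2}

/-- `J3LD n` (written `J''³(n)`): as `J3L n`, but additionally the three Latin squares
share the same constant value on the secondary diagonal (cells `(i, n-1-i)`). -/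
def J3LD (n : ℕ) : Set ℕ :=
  {k | ∃ L₁ L₂ L₃ : Fin n → Fin n → Fin n,
    IsLatin n L₁ ∧ IsLatin n L₂ ∧ IsLatin n L₃ ∧
    (∃ c, ∀ i : Fin n, L₁ i i.rev = c ∧ L₂ i i.rev = c ∧ L₃ i i.rev = c) ∧
    (agreeCells n L₁ L₂ L₃).card = k ∧
    ∀ p : Fin n × Fin n, p ∉ agreeCells n L₁ L₂ L₃ →
      L₁ p.1 p.2 ≠ L₂ p.1 p.2 ∧ L₁ p.1 p.2 ≠ L₃ p.1 p.2 ∧ L₂ p.1 p.2 ≠ L₃ p.1 p.2}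

/-- A pairwise balanced design `B(K, 1, v)`: blocks have sizes in `K` and every
2-element subset of the `v`-point set lies in exactly one block. -/
def IsPBD (v : ℕ) (K : Set ℕ) (A : Finset (Finset (Fin v))) : Prop :=
  (∀ b ∈ A, b.card ∈ K) ∧
  ∀ p : Finset (Fin v), p.card = 2 → ∃! b, b ∈ A ∧ p ⊆ b

/-- The functions `f k` coincide at every point of `F`, and take pairwise distinct values
at every other point. -/
def CoincideExactlyOn {ι α β : Type*} (f : ι → α → β) (F : Finset α) : Prop :=
  (∀ x ∈ F, ∀ k l, f k x = f l x) ∧ ∀ x ∉ F, Function.Injective fun k => f k x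

lemma exists_pointwise_distinct_perms {m : ℕ} (hm : m = 0 ∨ 3 ≤ m) :
    ∃ f : Fin 3 → Equiv.Perm (Fin m), ∀ i, Function.Injective fun k => f k i := by
  rcases hm with rfl | hm
  · exact ⟨fun _ => 1, fun i => i.elim0⟩
  · have : NeZero m := ⟨by omega⟩
    exact ⟨fun k => Equiv.addRight (Fin.castLE hm k), fun i k l h =>
      Fin.castLE_injective hm (add_left_cancel h)⟩

/-- Three permutations of `N` points can agree on exactly `b` points and be pairwise
distinct elsewhere, as soon as the number of remaining points is not `1` or `2`. -/
lemma exists_perms_coincideExactlyOn {N b : ℕ} (hb : b = N ∨ b + 3 ≤ N) :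
    ∃ (f : Fin 3 → Equiv.Perm (Fin N)) (F : Finset (Fin N)),
      F.card = b ∧ CoincideExactlyOn (fun k => ⇑(f k)) F := by
  obtain ⟨m, rfl⟩ : ∃ m, N = b + m := Nat.exists_eq_add_of_le (by omega)
  obtain ⟨g, hg⟩ := exists_pointwise_distinct_perms (m := m) (by omega)
  refine ⟨fun k => finSumFinEquiv.symm.trans
      (((Equiv.refl (Fin b)).sumCongr (g k)).trans finSumFinEquiv),
    Finset.univ.map (Fin.castAddEmb m), by simp, ?_, ?_⟩
  · intro x hx k l
    obtain ⟨i, rfl⟩ : ∃ i, Fin.castAdd m i = x := by simpa using hx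
    simp
  · intro x hx
    induction x using Fin.addCases with
    | left i => exact absurd (by simp) hx
    | right i =>
      intro k l h
      exact hg i (by simpa using h)

/-- The square of order `2n+1` obtained from a square `A` of order `n`, with the symbols
outside the subsquare renamed by `σ` and `τ`. -/
def extendedSquare {n : ℕ} (A : Fin n → Fin n → Fin n) (σ : Fin n → Fin n)
    (τ : Fin (n + 1) → Fin (n + 1)) :
    Fin n ⊕ Fin (n + 1) → Fin n ⊕ Fin (n + 1) → Fin n ⊕ Fin (n + 1)
  | .inl i, .inl j => .inl (A i j)
  | .inl i, .inr y => .inr (τ (y + i.succ))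
  | .inr x, .inl j => .inr (τ (x + j.succ))
  | .inr x, .inr y => Fin.cases (.inr (τ y)) (fun d => .inl (σ d)) (x - y)

section extendedSquare

variable {n : ℕ} {A : Fin n → Fin n → Fin n} {σ : Fin n → Fin n}
  {τ : Fin (n + 1) → Fin (n + 1)}

lemma extendedSquare_self (y : Fin (n + 1)) :
    extendedSquare A σ τ (.inr y) (.inr y) = .inr (τ y) := by
  simp [extendedSquare]

lemma extendedSquare_of_sub_eq_succ {x y : Fin (n + 1)} {d : Fin n} (h : x - y = d.succ) :
    extendedSquare A σ τ (.inr x) (.inr y) = .inl (σ d) := by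
  simp [extendedSquare, h]

/-- Either two indices coincide, or their difference is the successor of an index. -/
lemma eq_or_exists_sub_eq_succ (x y : Fin (n + 1)) : x = y ∨ ∃ d : Fin n, x - y = d.succ := by
  rcases Fin.eq_zero_or_eq_succ (x - y) with h | h
  · exact .inl (sub_eq_zero.mp h)
  · exact .inr h

lemma extendedSquare_row_injective (hA : ∀ i, Function.Injective (A i))
    (hσ : Function.Injective σ) (hτ : Function.Injective τ) (r : Fin n ⊕ Fin (n + 1)) :
    Function.Injective (extendedSquare A σ τ r) := by
  rcases r with i | x
  · rintro (j | y) (j' | y') h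
    · exact congrArg _ (hA i (Sum.inl_injective h))
    · cases h
    · cases h
    · exact congrArg _ (add_right_cancel (hτ (Sum.inr_injective h)))
  · have key : ∀ (j : Fin n) (y : Fin (n + 1)),
        extendedSquare A σ τ (.inr x) (.inl j) ≠ extendedSquare A σ τ (.inr x) (.inr y) := by
      intro j y h
      rcases eq_or_exists_sub_eq_succ x y with rfl | ⟨d, hd⟩
      · rw [extendedSquare_self] at h
        exact Fin.succ_ne_zero j (add_eq_left.mp (hτ (Sum.inr_injective h)))
      · rw [extendedSquare_of_sub_eq_succ hd] at h
        cases h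
    rintro (j | y) (j' | y') h
    · exact congrArg _ (Fin.succ_injective _ (add_left_cancel (hτ (Sum.inr_injective h))))
    · exact absurd h (key _ _)
    · exact absurd h.symm (key _ _)
    · rcases eq_or_exists_sub_eq_succ x y with rfl | ⟨d, hd⟩ <;>
      rcases eq_or_exists_sub_eq_succ x y' with rfl | ⟨d', hd'⟩
      · rfl
      · rw [extendedSquare_self, extendedSquare_of_sub_eq_succ hd'] at h
        cases h
      · rw [extendedSquare_self, extendedSquare_of_sub_eq_succ hd] at h
        cases h
      · rw [extendedSquare_of_sub_eq_succ hd, extendedSquare_of_sub_eq_succ hd'] at h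
        rw [hσ (Sum.inl_injective h), ← hd'] at hd
        exact congrArg _ (sub_right_injective hd)

lemma extendedSquare_column_injective (hA : ∀ j, Function.Injective fun i => A i j)
    (hσ : Function.Injective σ) (hτ : Function.Injective τ) (s : Fin n ⊕ Fin (n + 1)) :
    Function.Injective fun r => extendedSquare A σ τ r s := by
  rcases s with j | y
  · rintro (i | x) (i' | x') h
    · exact congrArg _ (hA j (Sum.inl_injective h))
    · cases h
    · cases h
    · exact congrArg _ (add_right_cancel (hτ (Sum.inr_injective h)))
  · have key : ∀ (i : Fin n) (x : Fin (n + 1)),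
        extendedSquare A σ τ (.inl i) (.inr y) ≠ extendedSquare A σ τ (.inr x) (.inr y) := by
      intro i x h
      rcases eq_or_exists_sub_eq_succ x y with rfl | ⟨d, hd⟩
      · rw [extendedSquare_self] at h
        exact Fin.succ_ne_zero i (add_eq_left.mp (hτ (Sum.inr_injective h)))
      · rw [extendedSquare_of_sub_eq_succ hd] at h
        cases h
    rintro (i | x) (i' | x') h <;> dsimp only at h
    · exact congrArg _ (Fin.succ_injective _ (add_left_cancel (hτ (Sum.inr_injective h))))
    · exact absurd h (key _ _)
    · exact absurd h.symm (key _ _)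
    · rcases eq_or_exists_sub_eq_succ x y with hx | ⟨d, hd⟩ <;>
      rcases eq_or_exists_sub_eq_succ x' y with hx' | ⟨d', hd'⟩
      · rw [hx, hx']
      · rw [hx, extendedSquare_self, extendedSquare_of_sub_eq_succ hd'] at h
        cases h
      · rw [hx', extendedSquare_self, extendedSquare_of_sub_eq_succ hd] at h
        cases h
      · rw [extendedSquare_of_sub_eq_succ hd, extendedSquare_of_sub_eq_succ hd'] at h
        rw [hσ (Sum.inl_injective h), ← hd'] at hd
        exact congrArg _ (sub_left_injective hd)

/-- The column in which a given row of the extended square contains the symbol `z`. -/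
def symbolColumn (z : Fin (n + 1)) : Fin n ⊕ Fin (n + 1) → Fin n ⊕ Fin (n + 1)
  | .inl i => .inr (z - i.succ)
  | .inr x => Fin.cases (.inr z) .inl (z - x)

lemma extendedSquare_symbolColumn (z : Fin (n + 1)) (r : Fin n ⊕ Fin (n + 1)) :
    extendedSquare A σ τ r (symbolColumn z r) = .inr (τ z) := by
  rcases r with i | x
  · simp [symbolColumn, extendedSquare]
  · rcases eq_or_exists_sub_eq_succ z x with rfl | ⟨d, hd⟩
    · simp [symbolColumn, extendedSquare]
    · simp only [symbolColumn, extendedSquare, hd, Fin.cases_succ]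
      rw [← hd, add_sub_cancel]

lemma symbolColumn_injective (z : Fin (n + 1)) :
    Function.Injective (symbolColumn z) := by
  intro r r' h
  refine extendedSquare_column_injective (A := fun i _ => i) (fun _ => Function.injective_id)
    Function.injective_id Function.injective_id (symbolColumn z r) ?_
  dsimp only
  rw [extendedSquare_symbolColumn, h, extendedSquare_symbolColumn]

/-- The cells in which extended squares coincide, given the corresponding cells `E` of the
subsquares and the symbols `B`, `C` that are renamed in the same way. -/
def IsExtendedCell (E : Finset (Fin n × Fin n)) (B : Finset (Fin n))
    (C : Finset (Fin (n + 1))) : Fin n ⊕ Fin (n + 1) → Fin n ⊕ Fin (n + 1) → Prop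
  | .inl i, .inl j => (i, j) ∈ E
  | .inl i, .inr y => y + i.succ ∈ C
  | .inr x, .inl j => x + j.succ ∈ C
  | .inr x, .inr y => Fin.cases (y ∈ C) (fun d => d ∈ B) (x - y)

variable {E : Finset (Fin n × Fin n)} {B : Finset (Fin n)} {C : Finset (Fin (n + 1))}

open Classical in
lemma card_extendedCells :
    (Finset.univ.filter fun p : (Fin n ⊕ Fin (n + 1)) × (Fin n ⊕ Fin (n + 1)) =>
      IsExtendedCell E B C p.1 p.2).card =
      E.card + (n + 1) * B.card + (2 * n + 1) * C.card := by
  have hC (d : Fin n) : (∑ y, if y + d.succ ∈ C then 1 else 0) = C.card := by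
    refine (Equiv.sum_comp (Equiv.addRight d.succ) fun y => if y ∈ C then 1 else 0).trans ?_
    simp
  have hr (i : Fin n) :
      (∑ y, if IsExtendedCell E B C (.inl i) (.inr y) then 1 else 0) = C.card := by
    convert hC i
    rfl
  have hc (j : Fin n) :
      (∑ x, if IsExtendedCell E B C (.inr x) (.inl j) then 1 else 0) = C.card := by
    convert hC j
    rfl
  have hE : (∑ i, ∑ j, if IsExtendedCell E B C (.inl i) (.inl j) then 1 else 0) = E.card := by
    rw [← Fintype.sum_prod_type'
      (f := fun i j => if IsExtendedCell E B C (.inl i) (.inl j) then 1 else 0)]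
    simp [IsExtendedCell]
  have hB (y : Fin (n + 1)) :
      (∑ x, if IsExtendedCell E B C (.inr x) (.inr y) then 1 else 0) =
        (if y ∈ C then 1 else 0) + B.card := by
    rw [← Equiv.sum_comp (Equiv.addRight y), Fin.sum_univ_succ]
    simp [IsExtendedCell]
  rw [Finset.card_filter, Fintype.sum_prod_type]
  simp only [Fintype.sum_sum_type, Finset.sum_add_distrib]
  rw [Finset.sum_comm (s := (Finset.univ : Finset (Fin (n + 1))))
      (t := (Finset.univ : Finset (Fin n))),
    Finset.sum_comm (s := (Finset.univ : Finset (Fin (n + 1))))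
      (t := (Finset.univ : Finset (Fin (n + 1))))]
  simp only [hr, hc, hE, hB, Finset.sum_add_distrib]
  simp only [Finset.sum_const, Finset.card_univ,
    Fintype.card_fin, smul_eq_mul, Finset.sum_boole, Finset.filter_univ_mem, Nat.cast_id]
  ring

open Classical in
lemma coincideExactlyOn_extendedSquare {ι : Type*} {A : ι → Fin n → Fin n → Fin n}
    {σ : ι → Fin n → Fin n} {τ : ι → Fin (n + 1) → Fin (n + 1)}
    (hA : CoincideExactlyOn (fun k (p : Fin n × Fin n) => A k p.1 p.2) E)
    (hσ : CoincideExactlyOn σ B) (hτ : CoincideExactlyOn τ C) :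
    CoincideExactlyOn
      (fun k (p : (Fin n ⊕ Fin (n + 1)) × (Fin n ⊕ Fin (n + 1))) =>
        extendedSquare (A k) (σ k) (τ k) p.1 p.2)
      (Finset.univ.filter fun p => IsExtendedCell E B C p.1 p.2) := by
  constructor
  · rintro ⟨i | x, j | y⟩ h k l <;> replace h := (Finset.mem_filter.mp h).2
    · exact congrArg _ (hA.1 (i, j) h k l)
    · exact congrArg _ (hτ.1 _ h k l)
    · exact congrArg _ (hτ.1 _ h k l)
    · rcases eq_or_exists_sub_eq_succ x y with rfl | ⟨d, hd⟩
      · simp only [extendedSquare_self]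
        exact congrArg _ (hτ.1 _ (by simpa [IsExtendedCell] using h) k l)
      · simp only [extendedSquare_of_sub_eq_succ hd]
        exact congrArg _ (hσ.1 _ (by simpa [IsExtendedCell, hd] using h) k l)
  · rintro ⟨i | x, j | y⟩ h <;>
      replace h := fun h' => h (Finset.mem_filter.mpr ⟨Finset.mem_univ _, h'⟩)
    · exact Sum.inl_injective.comp (hA.2 (i, j) h)
    · exact Sum.inr_injective.comp (hτ.2 _ h)
    · exact Sum.inr_injective.comp (hτ.2 _ h)
    · rcases eq_or_exists_sub_eq_succ x y with rfl | ⟨d, hd⟩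
      · simp only [extendedSquare_self]
        exact Sum.inr_injective.comp (hτ.2 _ fun h' => h (by simpa [IsExtendedCell] using h'))
      · simp only [extendedSquare_of_sub_eq_succ hd]
        exact Sum.inl_injective.comp (hσ.2 _ fun h' => h (by simpa [IsExtendedCell, hd] using h'))

end extendedSquare

lemma exists_family_of_mem_J3L {n a : ℕ} (ha : a ∈ J3L n) :
    ∃ (A : Fin 3 → Fin n → Fin n → Fin n) (E : Finset (Fin n × Fin n)),
      (∀ k, IsLatin n (A k)) ∧ E.card = a ∧
        CoincideExactlyOn (fun k (p : Fin n × Fin n) => A k p.1 p.2) E := by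
  obtain ⟨L₁, L₂, L₃, h₁, h₂, h₃, hcard, hne⟩ := ha
  refine ⟨![L₁, L₂, L₃], agreeCells n L₁ L₂ L₃, ?_, hcard, ?_, ?_⟩
  · simp [Fin.forall_fin_succ, h₁, h₂, h₃]
  · intro p hp
    obtain ⟨h, h'⟩ := (Finset.mem_filter.mp hp).2
    simp [Fin.forall_fin_succ, h, h']
  · intro p hp
    obtain ⟨h, h', h''⟩ := hne p hp
    intro k l
    fin_cases k <;> fin_cases l <;> simp [h, h', h'', h.symm, h'.symm, h''.symm]

/-- Three Latin squares on a type `Z` that contain the same symbol `z` in all cells `(r, g r)`,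
and coincide exactly on `F`, show that the size of `F` is a member of `J3LD`. -/
lemma card_mem_J3LD {Z : Type*} {N : ℕ} (e : Fin N ≃ Z) (g : Equiv.Perm Z)
    (M : Fin 3 → Z → Z → Z) (hrow : ∀ k r, Function.Injective (M k r))
    (hcol : ∀ k s, Function.Injective fun r => M k r s) (z : Z)
    (hz : ∀ k r, M k r (g r) = z) (F : Finset (Z × Z))
    (hF : CoincideExactlyOn (fun k (p : Z × Z) => M k p.1 p.2) F) :
    F.card ∈ J3LD N := by
  let col : Fin N ≃ Z := Fin.revPerm.trans (e.trans g)
  let L (k : Fin 3) (i j : Fin N) : Fin N := e.symm (M k (e i) (col j))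
  have hL (k : Fin 3) : IsLatin N (L k) :=
    ⟨fun i => e.symm.injective.comp ((hrow k (e i)).comp col.injective),
      fun j => e.symm.injective.comp ((hcol k (col j)).comp e.injective)⟩
  have hdist (p : Fin N × Fin N) (hp : (e p.1, col p.2) ∉ F) {k l : Fin 3} (hkl : k ≠ l) :
      L k p.1 p.2 ≠ L l p.1 p.2 := fun h => hkl (hF.2 _ hp (e.symm.injective h))
  have hmem (p : Fin N × Fin N) :
      p ∈ agreeCells N (L 0) (L 1) (L 2) ↔ (e p.1, col p.2) ∈ F := by
    rw [agreeCells, Finset.mem_filter]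
    constructor
    · rintro ⟨-, h, -⟩
      by_contra hp
      exact hdist p hp (by decide) h
    · exact fun hp => ⟨Finset.mem_univ _, congrArg e.symm (hF.1 _ hp 0 1),
        congrArg e.symm (hF.1 _ hp 1 2)⟩
  refine ⟨L 0, L 1, L 2, hL 0, hL 1, hL 2, ⟨e.symm z, fun i => ?_⟩, ?_, fun p hp => ?_⟩
  · simp [L, col, hz]
  · rw [← Finset.card_map (e.prodCongr col).symm.toEmbedding]
    congr 1
    ext p
    rw [hmem, Finset.mem_map_equiv]
    rfl
  · rw [hmem] at hp
    exact ⟨hdist p hp (by decide), hdist p hp (by decide), hdist p hp (by decide)⟩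

/-- For every `n ≥ 3`,
`J'³(n) + (n+1)·([0, n-3] ∪ {n}) + (2n+1)·([1, n-2] ∪ {n+1}) ⊆ J''³(2n+1)`. -/
theorem stmt2 (n : ℕ) (hn : 3 ≤ n) (a b c : ℕ)
    (ha : a ∈ J3L n)
    (hb : b ∈ Set.Icc 0 (n - 3) ∪ {n})
    (hc : c ∈ Set.Icc 1 (n - 2) ∪ {n + 1}) :
    a + (n + 1) * b + (2 * n + 1) * c ∈ J3LD (2 * n + 1) := by
  obtain ⟨A, E, hA, rfl, hE⟩ := exists_family_of_mem_J3L ha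
  obtain ⟨σ, B, rfl, hB⟩ := exists_perms_coincideExactlyOn (N := n) (b := b) (by
    simp only [Set.mem_union, Set.mem_Icc, Set.mem_singleton_iff] at hb
    omega)
  simp only [Set.mem_union, Set.mem_Icc, Set.mem_singleton_iff] at hc
  obtain ⟨τ, C, rfl, hC⟩ := exists_perms_coincideExactlyOn (N := n + 1) (b := c) (by omega)
  obtain ⟨z, hz⟩ := Finset.card_pos.mp (by omega : 0 < C.card)
  classical
  rw [← card_extendedCells]
  refine card_mem_J3LD ((finCongr (by omega)).trans finSumFinEquiv.symm)
    (Equiv.ofBijective _ (Finite.injective_iff_bijective.mp (symbolColumn_injective z)))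
    (fun k => extendedSquare (A k) (σ k) (τ k))
    (fun k => extendedSquare_row_injective (hA k).1 (σ k).injective (τ k).injective)
    (fun k => extendedSquare_column_injective (hA k).2 (σ k).injective (τ k).injective)
    (.inr (τ 0 z)) (fun k r => ?_) _ (coincideExactlyOn_extendedSquare hE hB hC)
  rw [Equiv.ofBijective_apply, extendedSquare_symbolColumn]
  exact congrArg _ (hC.1 z hz k 0)
end

section
/- For all admissible r, if b + (2r+1) ∈ J''³(2r+1) (i.e. there exist three Latin squares on the same 2r+1 symbols with the same constant secondary diagonal, agreeing pairwise on exactly b + 2r + 1 cells, 2r+1 of these being the secondary-diagonal cells, and containing pairwise distinct entries in all remaining cells), and if a₁, a₂ ∈ J³(2r+1) and a ∈ J³_F(r), then a₁ + a₂ + a + b ∈ J³_F(3r+1). -/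
namespace TripleConstruction

open Finset

variable {α β : Type*}

/-- A Steiner triple system on an arbitrary type of points. -/
def IsSteiner (B : Finset (Finset α)) : Prop :=
  (∀ b ∈ B, b.card = 3) ∧ ∀ x y, x ≠ y → ∃! b, b ∈ B ∧ x ∈ b ∧ y ∈ b

theorem isSTS_iff {v : ℕ} {B : Finset (Finset (Fin v))} : IsSTS v B ↔ IsSteiner B := by
  refine and_congr_right fun _ => ⟨fun h x y hxy => ?_, fun h p hp => ?_⟩
  · simpa [insert_subset_iff] using h {x, y} (card_pair hxy)
  · obtain ⟨x, y, hxy, rfl⟩ := card_eq_two.mp hp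
    simpa [insert_subset_iff] using h x y hxy

/-- The image of a family of blocks under a bijection of the points. -/
def relabel (e : α ≃ β) (B : Finset (Finset α)) : Finset (Finset β) :=
  B.map e.finsetCongr.toEmbedding

theorem mem_relabel {e : α ≃ β} {B : Finset (Finset α)} {b : Finset β} :
    b ∈ relabel e B ↔ b.map e.symm.toEmbedding ∈ B := by
  simp [relabel, mem_map_equiv]

theorem card_relabel (e : α ≃ β) (B : Finset (Finset α)) : (relabel e B).card = B.card :=
  card_map _

theorem IsSteiner.relabel {B : Finset (Finset α)} (hB : IsSteiner B) (e : α ≃ β) :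
    IsSteiner (relabel e B) := by
  refine ⟨fun b hb => by simpa using hB.1 _ (mem_relabel.mp hb), fun x y hxy => ?_⟩
  obtain ⟨b, ⟨hb, hx, hy⟩, huniq⟩ := hB.2 (e.symm x) (e.symm y) (by simpa using hxy)
  refine ⟨b.map e.toEmbedding, ⟨by simpa [mem_relabel, Finset.map_map] using hb, ?_, ?_⟩, ?_⟩
  · simpa [mem_map_equiv] using hx
  · simpa [mem_map_equiv] using hy
  · rintro c ⟨hc, hcx, hcy⟩
    rw [← huniq _ ⟨mem_relabel.mp hc, by simpa using hcx, by simpa using hcy⟩]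
    simp [Finset.map_map]

theorem nonempty_of_mem_disjSum {B : Fin 3 → Finset (Finset α)} (hB : ∀ k, ∀ c ∈ B k, c.card = 3)
    (T : Finset (Fin 3 → α)) :
    (((univ.sigma B).disjSum T : Finset _) : Set _) ⊆
      {s : (Σ _ : Fin 3, Finset α) ⊕ (Fin 3 → α) | ∀ k c, s = .inl ⟨k, c⟩ → c.Nonempty} := by
  rintro s hs k c rfl
  have hc : c ∈ B k := by simpa using hs
  rw [← card_pos, hB k c hc]
  norm_num

variable [DecidableEq α] [DecidableEq β]

theorem relabel_inter (e : α ≃ β) (B C : Finset (Finset α)) :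
    relabel e B ∩ relabel e C = relabel e (B ∩ C) :=
  (map_inter _ _).symm

/-- Every point of a Steiner triple system on `2 * r + 1` points lies in exactly `r` triples. -/
theorem IsSteiner.card_flower [Fintype α] {B : Finset (Finset α)} (hB : IsSteiner B) {r : ℕ}
    (hα : Fintype.card α = 2 * r + 1) (x : α) : (B.filter (x ∈ ·)).card = r := by
  have hunion : (B.filter (x ∈ ·)).biUnion (fun b => b.erase x) = univ.erase x := by
    ext y
    simp only [mem_biUnion, mem_filter, mem_erase, mem_univ, and_true]
    constructor
    · rintro ⟨b, -, hy, -⟩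
      exact hy
    · intro hy
      obtain ⟨b, ⟨hb, hx, hyb⟩, -⟩ := hB.2 x y hy.symm
      exact ⟨b, ⟨hb, hx⟩, hy, hyb⟩
  have hdisj : ∀ b ∈ B.filter (x ∈ ·), ∀ c ∈ B.filter (x ∈ ·), b ≠ c →
      Disjoint (b.erase x) (c.erase x) := by
    intro b hb c hc hbc
    rw [mem_filter] at hb hc
    rw [disjoint_left]
    intro y hyb hyc
    rw [mem_erase] at hyb hyc
    exact hbc ((hB.2 x y hyb.1.symm).unique ⟨hb.1, hb.2, hyb.2⟩ ⟨hc.1, hc.2, hyc.2⟩)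
  have hcard := card_biUnion hdisj
  rw [hunion, card_erase_of_mem (mem_univ x), card_univ, hα,
    sum_congr rfl fun b hb => (by
      rw [mem_filter] at hb
      rw [card_erase_of_mem hb.2, hB.1 b hb.1] : (b.erase x).card = 2)] at hcard
  simp only [sum_const, smul_eq_mul] at hcard
  omega

/-- The block `{k} × c` inside the level `k`, or the graph of `t : Fin 3 → α`. -/
def block : (Σ _ : Fin 3, Finset α) ⊕ (Fin 3 → α) → Finset (Fin 3 × α)
  | .inl s => s.2.image (Prod.mk s.1)
  | .inr t => univ.image fun k => (k, t k)

theorem mem_block_inl {k l : Fin 3} {c : Finset α} {x : α} :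
    (l, x) ∈ block (.inl ⟨k, c⟩) ↔ k = l ∧ x ∈ c := by
  simp [block, and_comm]

theorem mem_block_inr {l : Fin 3} {t : Fin 3 → α} {x : α} :
    (l, x) ∈ block (.inr t) ↔ t l = x := by
  simp [block]

theorem block_injOn :
    Set.InjOn (block (α := α)) {s | ∀ k c, s = .inl ⟨k, c⟩ → c.Nonempty} := by
  have hne : ∀ (k : Fin 3) (c : Finset α) (t : Fin 3 → α), block (.inl ⟨k, c⟩) ≠ block (.inr t) := by
    intro k c t h
    have h' : ∀ l, k = l := fun l =>
      (mem_block_inl.mp (h ▸ mem_block_inr.mpr rfl : (l, t l) ∈ block (.inl ⟨k, c⟩))).1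
    exact absurd ((h' 0).symm.trans (h' 1)) (by decide)
  rintro (⟨k, c⟩ | t) hs (⟨k', c'⟩ | t') hs' h
  · obtain ⟨x, hx⟩ := hs k c rfl
    obtain ⟨rfl, -⟩ := mem_block_inl.mp
      (h ▸ mem_block_inl.mpr ⟨rfl, hx⟩ : (k, x) ∈ block (.inl ⟨k', c'⟩))
    congr 2
    ext y
    simpa [mem_block_inl] using congrArg ((k', y) ∈ ·) h
  · exact absurd h (hne _ _ _)
  · exact absurd h.symm (hne _ _ _)
  · congr 1
    ext k
    exact (mem_block_inr.mp (h ▸ mem_block_inr.mpr rfl : (k, t k) ∈ block (.inr t'))).symm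

/-- The blocks of the families `B k` on the three levels, together with the transversals in `T`. -/
def tripling (B : Fin 3 → Finset (Finset α)) (T : Finset (Fin 3 → α)) :
    Finset (Finset (Fin 3 × α)) :=
  ((univ.sigma B).disjSum T).image block

theorem mem_tripling {B : Fin 3 → Finset (Finset α)} {T : Finset (Fin 3 → α)}
    {b : Finset (Fin 3 × α)} :
    b ∈ tripling B T ↔
      (∃ k, ∃ c ∈ B k, block (.inl ⟨k, c⟩) = b) ∨ ∃ t ∈ T, block (.inr t) = b := by
  simp [tripling]

theorem tripling_inter {B C : Fin 3 → Finset (Finset α)} (hB : ∀ k, ∀ c ∈ B k, c.card = 3)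
    (hC : ∀ k, ∀ c ∈ C k, c.card = 3) (T U : Finset (Fin 3 → α)) :
    tripling B T ∩ tripling C U = tripling (fun k => B k ∩ C k) (T ∩ U) := by
  rw [tripling, tripling, tripling, ← image_inter_of_injOn]
  · congr 1
    ext (⟨k, c⟩ | t) <;> simp
  · exact block_injOn.mono (Set.union_subset (nonempty_of_mem_disjSum hB T) (nonempty_of_mem_disjSum hC U))

theorem card_tripling {B : Fin 3 → Finset (Finset α)} (hB : ∀ k, ∀ c ∈ B k, c.card = 3)
    (T : Finset (Fin 3 → α)) :
    (tripling B T).card = ∑ k, (B k).card + T.card := by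
  rw [tripling, card_image_of_injOn (block_injOn.mono (nonempty_of_mem_disjSum hB T)), card_disjSum,
    card_sigma]

/-- A transversal design with three groups: two points of different groups lie on exactly one
transversal. -/
def IsTransversal (T : Finset (Fin 3 → α)) : Prop :=
  ∀ k l, k ≠ l → ∀ x y, ∃! t, t ∈ T ∧ t k = x ∧ t l = y

theorem IsTransversal.isSteiner_tripling {B : Fin 3 → Finset (Finset α)}
    {T : Finset (Fin 3 → α)} (hT : IsTransversal T) (hB : ∀ k, IsSteiner (B k)) :
    IsSteiner (tripling B T) := by
  constructor
  · intro b hb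
    obtain ⟨k, c, hc, rfl⟩ | ⟨t, -, rfl⟩ := mem_tripling.mp hb
    · rw [block, card_image_of_injective _ (Prod.mk_right_injective k)]
      exact (hB k).1 c hc
    · rw [block, card_image_of_injective _ fun k l h => (Prod.ext_iff.mp h).1]
      simp
  · rintro ⟨k, x⟩ ⟨l, y⟩ hxy
    by_cases hkl : k = l
    · subst hkl
      have hxy' : x ≠ y := fun h => hxy (h ▸ rfl)
      obtain ⟨c, ⟨hc, hx, hy⟩, huniq⟩ := (hB k).2 x y hxy'
      refine ⟨_, ⟨mem_tripling.mpr (.inl ⟨k, c, hc, rfl⟩), mem_block_inl.mpr ⟨rfl, hx⟩,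
        mem_block_inl.mpr ⟨rfl, hy⟩⟩, ?_⟩
      rintro b ⟨hb, hbx, hby⟩
      obtain ⟨k', c', hc', rfl⟩ | ⟨t, -, rfl⟩ := mem_tripling.mp hb
      · obtain ⟨rfl, hx'⟩ := mem_block_inl.mp hbx
        rw [huniq c' ⟨hc', hx', (mem_block_inl.mp hby).2⟩]
      · exact absurd ((mem_block_inr.mp hbx).symm.trans (mem_block_inr.mp hby)) hxy'
    · obtain ⟨t, ⟨ht, hx, hy⟩, huniq⟩ := hT k l hkl x y
      refine ⟨_, ⟨mem_tripling.mpr (.inr ⟨t, ht, rfl⟩), mem_block_inr.mpr hx,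
        mem_block_inr.mpr hy⟩, ?_⟩
      rintro b ⟨hb, hbx, hby⟩
      obtain ⟨k', c', -, rfl⟩ | ⟨t', ht', rfl⟩ := mem_tripling.mp hb
      · exact absurd ((mem_block_inl.mp hbx).1.symm.trans (mem_block_inl.mp hby).1) hkl
      · rw [huniq t' ⟨ht', mem_block_inr.mp hbx, mem_block_inr.mp hby⟩]

/-- The triples (row, column, symbol) of a square. -/
def transversals {n : ℕ} (L : Fin n → Fin n → Fin n) : Finset (Fin 3 → Fin n) :=
  univ.filter fun t => L (t 0) (t 1) = t 2

theorem mem_transversals {n : ℕ} {L : Fin n → Fin n → Fin n} {t : Fin 3 → Fin n} :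
    t ∈ transversals L ↔ L (t 0) (t 1) = t 2 := by
  simp [transversals]

theorem isTransversal_transversals {n : ℕ} {L : Fin n → Fin n → Fin n} (hL : IsLatin n L) :
    IsTransversal (transversals L) := by
  have h01 : ∀ x y, ∃! t, t ∈ transversals L ∧ t 0 = x ∧ t 1 = y := by
    intro x y
    refine ⟨![x, y, L x y], by simp [mem_transversals], ?_⟩
    rintro t ⟨ht, rfl, rfl⟩
    rw [mem_transversals] at ht
    ext k
    fin_cases k <;> simp [ht]
  have h02 : ∀ x y, ∃! t, t ∈ transversals L ∧ t 0 = x ∧ t 2 = y := by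
    intro x y
    obtain ⟨z, rfl⟩ := (Finite.injective_iff_surjective.mp (hL.1 x)) y
    refine ⟨![x, z, L x z], by simp [mem_transversals], ?_⟩
    rintro t ⟨ht, rfl, h2⟩
    rw [mem_transversals, h2] at ht
    have h1 := hL.1 _ ht
    ext k
    fin_cases k <;> simp [h1, h2]
  have h12 : ∀ x y, ∃! t, t ∈ transversals L ∧ t 1 = x ∧ t 2 = y := by
    intro x y
    obtain ⟨z, rfl⟩ := (Finite.injective_iff_surjective.mp (hL.2 x)) y
    refine ⟨![z, x, L z x], by simp [mem_transversals], ?_⟩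
    rintro t ⟨ht, rfl, h2⟩
    rw [mem_transversals, h2] at ht
    have h0 := hL.2 _ ht
    ext k
    fin_cases k <;> simp [h0, h2]
  intro k l hkl x y
  fin_cases k <;> fin_cases l
  · exact absurd rfl hkl
  · exact h01 x y
  · exact h02 x y
  · simpa only [and_comm (b := _ = x)] using! h01 y x
  · exact absurd rfl hkl
  · exact h12 x y
  · simpa only [and_comm (b := _ = x)] using! h02 y x
  · simpa only [and_comm (b := _ = x)] using! h12 y x
  · exact absurd rfl hkl

theorem IsLatin.eq_rev {n : ℕ} {L : Fin n → Fin n → Fin n} (hL : IsLatin n L) {c : Fin n}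
    (hc : ∀ i, L i i.rev = c) {i j : Fin n} (h : L i j = c) : j = i.rev :=
  hL.1 i (h.trans (hc i).symm)

section Sunflower

/-- Any two of the three sets intersect in the same set. -/
def Sunflower (A B C : Finset α) : Prop := A ∩ B = A ∩ C ∧ A ∩ B = B ∩ C

theorem Sunflower.relabel {A B C : Finset (Finset α)} (h : Sunflower A B C) (e : α ≃ β) :
    Sunflower (relabel e A) (relabel e B) (relabel e C) := by
  simp only [Sunflower, relabel_inter, ← h.1, ← h.2, and_self]

theorem Sunflower.tripling {A B C : Fin 3 → Finset (Finset α)} {T U V : Finset (Fin 3 → α)}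
    (hA : ∀ k, ∀ c ∈ A k, c.card = 3) (hB : ∀ k, ∀ c ∈ B k, c.card = 3)
    (hC : ∀ k, ∀ c ∈ C k, c.card = 3) (h : ∀ k, Sunflower (A k) (B k) (C k))
    (hT : Sunflower T U V) :
    Sunflower (tripling A T) (tripling B U) (tripling C V) := by
  simp only [Sunflower, tripling_inter hA hB, tripling_inter hA hC, tripling_inter hB hC,
    ← (h _).1, ← (h _).2, ← hT.1, ← hT.2, and_self]

variable {n : ℕ} {L₁ L₂ L₃ : Fin n → Fin n → Fin n}

theorem transversals_inter (h : ∀ p : Fin n × Fin n, p ∉ agreeCells n L₁ L₂ L₃ →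
      L₁ p.1 p.2 ≠ L₂ p.1 p.2 ∧ L₁ p.1 p.2 ≠ L₃ p.1 p.2 ∧ L₂ p.1 p.2 ≠ L₃ p.1 p.2) :
    transversals L₁ ∩ transversals L₂ =
      (agreeCells n L₁ L₂ L₃).image fun p => ![p.1, p.2, L₁ p.1 p.2] := by
  ext t
  simp only [mem_inter, mem_transversals, mem_image]
  constructor
  · rintro ⟨h1, h2⟩
    refine ⟨(t 0, t 1), ?_, ?_⟩
    · by_contra hp
      exact (h _ hp).1 (h1.trans h2.symm)
    · ext k
      fin_cases k <;> simp [h1]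
  · rintro ⟨p, hp, rfl⟩
    simp only [agreeCells, mem_filter] at hp
    simpa using hp.2.1.symm

theorem sunflower_transversals (h : ∀ p : Fin n × Fin n, p ∉ agreeCells n L₁ L₂ L₃ →
      L₁ p.1 p.2 ≠ L₂ p.1 p.2 ∧ L₁ p.1 p.2 ≠ L₃ p.1 p.2 ∧ L₂ p.1 p.2 ≠ L₃ p.1 p.2) :
    Sunflower (transversals L₁) (transversals L₂) (transversals L₃) := by
  constructor <;>
  · ext t
    have ht := h (t 0, t 1)
    simp only [agreeCells, mem_filter, mem_univ, true_and] at ht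
    simp only [mem_inter, mem_transversals]
    grind

theorem card_transversals_inter (h : ∀ p : Fin n × Fin n, p ∉ agreeCells n L₁ L₂ L₃ →
      L₁ p.1 p.2 ≠ L₂ p.1 p.2 ∧ L₁ p.1 p.2 ≠ L₃ p.1 p.2 ∧ L₂ p.1 p.2 ≠ L₃ p.1 p.2) :
    (transversals L₁ ∩ transversals L₂).card = (agreeCells n L₁ L₂ L₃).card := by
  rw [transversals_inter h]
  refine card_image_of_injective _ fun p q hpq => ?_
  exact Prod.ext (congrFun hpq 0) (congrFun hpq 1)

end Sunflower

/-- The two families of blocks have the same flower at `x`. -/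
def SameFlower (B C : Finset (Finset α)) (x : α) : Prop :=
  B.filter (x ∈ ·) = C.filter (x ∈ ·)

theorem SameFlower.relabel {B C : Finset (Finset α)} {x : α} (h : SameFlower B C x)
    (e : α ≃ β) : SameFlower (relabel e B) (relabel e C) (e x) := by
  ext b
  have hb := Finset.ext_iff.mp h (b.map e.symm.toEmbedding)
  simpa [mem_relabel, mem_map_equiv] using hb

theorem SameFlower.tripling {B C : Fin 3 → Finset (Finset α)} {T U : Finset (Fin 3 → α)}
    {k : Fin 3} {x : α} (h : SameFlower (B k) (C k) x)
    (hT : ∀ t : Fin 3 → α, t k = x → (t ∈ T ↔ t ∈ U)) :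
    SameFlower (tripling B T) (tripling C U) (k, x) := by
  have hmem : ∀ c, x ∈ c → (c ∈ B k ↔ c ∈ C k) := fun c hc => by
    simpa [hc] using Finset.ext_iff.mp h c
  ext b
  simp only [mem_filter, mem_tripling]
  refine and_congr_left fun hb => or_congr ?_ ?_
  · constructor <;> rintro ⟨l, c, hc, rfl⟩ <;> obtain ⟨rfl, hx⟩ := mem_block_inl.mp hb
    · exact ⟨l, c, (hmem c hx).mp hc, rfl⟩
    · exact ⟨l, c, (hmem c hx).mpr hc, rfl⟩
  · constructor <;> rintro ⟨t, ht, rfl⟩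
    · exact ⟨t, (hT t (mem_block_inr.mp hb)).mp ht, rfl⟩
    · exact ⟨t, (hT t (mem_block_inr.mp hb)).mpr ht, rfl⟩

theorem mem_transversals_iff {n : ℕ} {L M : Fin n → Fin n → Fin n} (hL : IsLatin n L)
    (hM : IsLatin n M) {c : Fin n} (hLc : ∀ i, L i i.rev = c) (hMc : ∀ i, M i i.rev = c)
    (t : Fin 3 → Fin n) (ht : t 2 = c) : t ∈ transversals L ↔ t ∈ transversals M := by
  rw [mem_transversals, mem_transversals, ht]
  constructor <;> intro h
  · rw [IsLatin.eq_rev hL hLc h, hMc]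
  · rw [IsLatin.eq_rev hM hMc h, hLc]

end TripleConstruction

open TripleConstruction in
/-- For all admissible `r`, if there exist three Latin squares of order
`2r+1` with the same constant secondary diagonal agreeing pairwise on exactly
`b + 2r + 1` cells (`2r+1` of these being the secondary-diagonal cells) and pairwise
distinct elsewhere, and if `a₁, a₂ ∈ J³(2r+1)` and `a ∈ J³_F(r)`, then
`a₁ + a₂ + a + b ∈ J³_F(3r+1)`. -/
theorem stmt3 (r : ℕ) (hadm : r % 3 = 0 ∨ r % 3 = 1) (b a₁ a₂ a : ℕ)
    (hb : b + (2 * r + 1) ∈ J3LD (2 * r + 1))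
    (h₁ : a₁ ∈ J3 (2 * r + 1)) (h₂ : a₂ ∈ J3 (2 * r + 1)) (ha : a ∈ J3F r) :
    a₁ + a₂ + a + b ∈ J3F (3 * r + 1) := by
  obtain ⟨L₁, L₂, L₃, hL₁, hL₂, hL₃, ⟨c, hc⟩, hLcard, hL⟩ := hb
  obtain ⟨P₁, P₂, P₃, hP₁, hP₂, hP₃, hP, hP', hPcard⟩ := h₁
  obtain ⟨Q₁, Q₂, Q₃, hQ₁, hQ₂, hQ₃, hQ, hQ', hQcard⟩ := h₂
  obtain ⟨R₁, R₂, R₃, x, hR₁, hR₂, hR₃, hR, hR', hRcard, hF, hF', -⟩ := ha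
  rw [isSTS_iff] at hP₁ hP₂ hP₃ hQ₁ hQ₂ hQ₃ hR₁ hR₂ hR₃
  let σ : Equiv.Perm (Fin (2 * r + 1)) := Equiv.swap x c
  have hσ : σ x = c := Equiv.swap_apply_left x c
  have h₁ : ∀ k, IsSteiner ((![P₁, Q₁, relabel σ R₁] : Fin 3 → _) k) :=
    Fin.forall_fin_succ.mpr ⟨hP₁, Fin.forall_fin_two.mpr ⟨hQ₁, hR₁.relabel σ⟩⟩
  have h₂ : ∀ k, IsSteiner ((![P₂, Q₂, relabel σ R₂] : Fin 3 → _) k) :=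
    Fin.forall_fin_succ.mpr ⟨hP₂, Fin.forall_fin_two.mpr ⟨hQ₂, hR₂.relabel σ⟩⟩
  have h₃ : ∀ k, IsSteiner ((![P₃, Q₃, relabel σ R₃] : Fin 3 → _) k) :=
    Fin.forall_fin_succ.mpr ⟨hP₃, Fin.forall_fin_two.mpr ⟨hQ₃, hR₃.relabel σ⟩⟩
  have hsun : ∀ k, Sunflower ((![P₁, Q₁, relabel σ R₁] : Fin 3 → _) k)
      ((![P₂, Q₂, relabel σ R₂] : Fin 3 → _) k) ((![P₃, Q₃, relabel σ R₃] : Fin 3 → _) k) :=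
    Fin.forall_fin_succ.mpr ⟨⟨hP, hP'⟩, Fin.forall_fin_two.mpr ⟨⟨hQ, hQ'⟩,
      Sunflower.relabel ⟨hR, hR'⟩ σ⟩⟩
  let e : Fin 3 × Fin (2 * r + 1) ≃ Fin (2 * (3 * r + 1) + 1) :=
    Fintype.equivFinOfCardEq (by simp; ring)
  have hS₁ := ((isTransversal_transversals hL₁).isSteiner_tripling h₁).relabel e
  have hS₂ := ((isTransversal_transversals hL₂).isSteiner_tripling h₂).relabel e
  have hS₃ := ((isTransversal_transversals hL₃).isSteiner_tripling h₃).relabel e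
  have hS := (Sunflower.tripling (fun k => (h₁ k).1) (fun k => (h₂ k).1) (fun k => (h₃ k).1) hsun
    (sunflower_transversals hL)).relabel e
  refine ⟨_, _, _, e (2, c), isSTS_iff.mpr hS₁, isSTS_iff.mpr hS₂, isSTS_iff.mpr hS₃, hS.1, hS.2,
    ?_, SameFlower.relabel (SameFlower.tripling ?_ ?_) e,
    SameFlower.relabel (SameFlower.tripling ?_ ?_) e, hS₁.card_flower (r := 3 * r + 1) (by simp) _⟩
  · rw [relabel_inter, card_relabel, tripling_inter (fun k => (h₁ k).1) (fun k => (h₂ k).1),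
      card_tripling fun k c hc => (h₁ k).1 c (Finset.mem_of_mem_inter_left hc),
      card_transversals_inter hL, hLcard, Fin.sum_univ_three]
    simp only [Matrix.cons_val_zero, Matrix.cons_val_one, Matrix.cons_val, relabel_inter,
      card_relabel, hPcard, hQcard, hRcard]
    ring
  · exact hσ ▸ SameFlower.relabel hF σ
  · exact mem_transversals_iff hL₁ hL₂ (fun i => (hc i).1) fun i => (hc i).2.1
  · exact hσ ▸ SameFlower.relabel hF' σ
  · exact mem_transversals_iff hL₁ hL₃ (fun i => (hc i).1) fun i => (hc i).2.2
end

section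
/- For all admissible r, if b ∈ J'³(2r) and a₁, a₂, a₃ ∈ J³_F(r), then a₁ + a₂ + a₃ + b ∈ J³_F(3r). -/
/-- A Steiner triple system on an arbitrary point type, stated through pairs of distinct points. -/
def IsSteiner {α : Type*} (B : Finset (Finset α)) : Prop :=
  (∀ t ∈ B, t.card = 3) ∧ ∀ a b, a ≠ b → ∃! t, t ∈ B ∧ a ∈ t ∧ b ∈ t

/-- Three Steiner triple systems that pairwise meet in the same `k` triples and have the same
flower, of `s` triples, at the point `x`. -/
def SharesFlower {α : Type*} [DecidableEq α] (x : α) (k s : ℕ)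
    (B₁ B₂ B₃ : Finset (Finset α)) : Prop :=
  IsSteiner B₁ ∧ IsSteiner B₂ ∧ IsSteiner B₃ ∧
    B₁ ∩ B₂ = B₁ ∩ B₃ ∧ B₁ ∩ B₂ = B₂ ∩ B₃ ∧ (B₁ ∩ B₂).card = k ∧
    B₁.filter (x ∈ ·) = B₂.filter (x ∈ ·) ∧ B₁.filter (x ∈ ·) = B₃.filter (x ∈ ·) ∧
    (B₁.filter (x ∈ ·)).card = s

lemma isSTS_iff_isSteiner {v : ℕ} {B : Finset (Finset (Fin v))} : IsSTS v B ↔ IsSteiner B := by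
  refine and_congr_right fun _ => ⟨fun h a b hab => ?_, fun h p hp => ?_⟩
  · simpa [Finset.insert_subset_iff] using h {a, b} (Finset.card_pair hab)
  · obtain ⟨a, b, hab, rfl⟩ := Finset.card_eq_two.mp hp
    simpa [Finset.insert_subset_iff] using h a b hab

lemma IsSteiner.map {α β : Type*} (e : α ≃ β) {B : Finset (Finset α)} (h : IsSteiner B) :
    IsSteiner (B.map e.finsetCongr.toEmbedding) := by
  refine ⟨?_, fun a b hab => ?_⟩
  · intro t ht
    obtain ⟨w, hw, rfl⟩ := Finset.mem_map.mp ht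
    simpa using h.1 w hw
  · obtain ⟨t, ⟨ht, hat, hbt⟩, huniq⟩ := h.2 (e.symm a) (e.symm b) (by simpa using hab)
    refine ⟨t.map e.toEmbedding, ⟨?_, ?_, ?_⟩, ?_⟩
    · exact Finset.mem_map_of_mem _ ht
    · simpa [Finset.mem_map_equiv] using hat
    · simpa [Finset.mem_map_equiv] using hbt
    · rintro u ⟨hu, hau, hbu⟩
      obtain ⟨w, hw, rfl⟩ := Finset.mem_map.mp hu
      simp only [Equiv.coe_toEmbedding, Equiv.finsetCongr_apply, Finset.mem_map_equiv] at hau hbu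
      simp [huniq w ⟨hw, hau, hbu⟩]

lemma SharesFlower.map {α β : Type*} [DecidableEq α] [DecidableEq β] (e : α ≃ β) {x : α}
    {k s : ℕ} {B₁ B₂ B₃ : Finset (Finset α)} (h : SharesFlower x k s B₁ B₂ B₃) :
    SharesFlower (e x) k s (B₁.map e.finsetCongr.toEmbedding)
      (B₂.map e.finsetCongr.toEmbedding) (B₃.map e.finsetCongr.toEmbedding) := by
  obtain ⟨h₁, h₂, h₃, h₁₃, h₂₃, hk, hf₂, hf₃, hs⟩ := h
  have hfilter (B : Finset (Finset α)) :
      (B.map e.finsetCongr.toEmbedding).filter (e x ∈ ·) =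
        (B.filter (x ∈ ·)).map e.finsetCongr.toEmbedding := by
    rw [Finset.filter_map]
    congr 1
    ext t
    simp
  refine ⟨h₁.map e, h₂.map e, h₃.map e, ?_, ?_, ?_, ?_, ?_, ?_⟩
  · rw [← Finset.map_inter, ← Finset.map_inter, h₁₃]
  · rw [← Finset.map_inter, ← Finset.map_inter, h₂₃]
  · rw [← Finset.map_inter, Finset.card_map, hk]
  · rw [hfilter, hfilter, hf₂]
  · rw [hfilter, hfilter, hf₃]
  · rw [hfilter, Finset.card_map, hs]

lemma mem_J3F_of_sharesFlower {α : Type*} [DecidableEq α] [Fintype α] {r k : ℕ} {x : α}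
    {B₁ B₂ B₃ : Finset (Finset α)} (hα : Fintype.card α = 2 * r + 1)
    (h : SharesFlower x (k + r) r B₁ B₂ B₃) : k ∈ J3F r := by
  have h' := h.map (Fintype.equivFinOfCardEq hα)
  simp only [SharesFlower, ← isSTS_iff_isSteiner] at h'
  exact ⟨_, _, _, _, h'⟩

lemma exists_sharesFlower_of_mem_J3F {r k : ℕ} (h : k ∈ J3F r) :
    ∃ B₁ B₂ B₃ : Finset (Finset (Option (Fin (2 * r)))),
      SharesFlower none (k + r) r B₁ B₂ B₃ := by
  obtain ⟨B₁, B₂, B₃, x, h⟩ := h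
  simp only [isSTS_iff_isSteiner] at h
  have h' := SharesFlower.map (finSuccEquiv' x) (show SharesFlower x _ _ B₁ B₂ B₃ from h)
  rw [finSuccEquiv'_at] at h'
  exact ⟨_, _, _, h'⟩

section Tripling

variable {n : ℕ}

/-- The triples of the tripling construction: either a triple inside the `i`-th group extended by
the common point `none`, or a transversal of the three groups. -/
def triplingBlock :
    (Σ _ : Fin 3, Finset (Option (Fin n))) ⊕ (Fin 3 → Fin n) → Finset (Option (Fin 3 × Fin n))
  | .inl ⟨i, t⟩ => t.image (Option.map (Prod.mk i))
  | .inr p => Finset.univ.image fun j => some (j, p j)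

/-- The triples on three groups obtained from the families `B i` inside the groups and the
transversals `R`. -/
def tripling (B : Fin 3 → Finset (Finset (Option (Fin n)))) (R : Finset (Fin 3 → Fin n)) :
    Finset (Finset (Option (Fin 3 × Fin n))) :=
  ((Finset.univ.sigma B).disjSum R).image triplingBlock

lemma none_mem_triplingBlock_inl (i : Fin 3) (t : Finset (Option (Fin n))) :
    none ∈ triplingBlock (.inl ⟨i, t⟩) ↔ none ∈ t := by
  simp [triplingBlock]

lemma some_mem_triplingBlock_inl (i j : Fin 3) (y : Fin n) (t : Finset (Option (Fin n))) :
    some (j, y) ∈ triplingBlock (.inl ⟨i, t⟩) ↔ i = j ∧ some y ∈ t := by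
  simp only [triplingBlock, Finset.mem_image, Option.map_eq_some_iff, Prod.mk.injEq]
  constructor
  · rintro ⟨_, h, _, rfl, rfl, rfl⟩
    exact ⟨rfl, h⟩
  · rintro ⟨rfl, h⟩
    exact ⟨_, h, _, rfl, rfl, rfl⟩

lemma none_notMem_triplingBlock_inr (p : Fin 3 → Fin n) : none ∉ triplingBlock (.inr p) := by
  simp [triplingBlock]

lemma some_mem_triplingBlock_inr (p : Fin 3 → Fin n) (j : Fin 3) (y : Fin n) :
    some (j, y) ∈ triplingBlock (.inr p) ↔ p j = y := by
  simp [triplingBlock]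

lemma card_triplingBlock_inl (i : Fin 3) (t : Finset (Option (Fin n))) :
    (triplingBlock (.inl ⟨i, t⟩)).card = t.card :=
  Finset.card_image_of_injective _ (Option.map_injective (Prod.mk_right_injective i))

lemma card_triplingBlock_inr (p : Fin 3 → Fin n) : (triplingBlock (.inr p)).card = 3 := by
  rw [triplingBlock, Finset.card_image_of_injective, Finset.card_univ, Fintype.card_fin]
  intro i j h
  simp only [Option.some.injEq, Prod.mk.injEq] at h
  exact h.1

lemma exists_some_mem_of_card_eq_three {t : Finset (Option (Fin n))} (ht : t.card = 3) :
    ∃ y, some y ∈ t := by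
  obtain ⟨a, ha, hne⟩ := Finset.exists_mem_ne (by omega : 1 < t.card) none
  obtain ⟨y, rfl⟩ := Option.ne_none_iff_exists'.mp hne
  exact ⟨y, ha⟩

lemma triplingBlock_inl_ne_inr {i : Fin 3} {t : Finset (Option (Fin n))} {p : Fin 3 → Fin n} :
    triplingBlock (.inl ⟨i, t⟩) ≠ triplingBlock (.inr p) := by
  intro h
  have hmem (j : Fin 3) : i = j :=
    ((some_mem_triplingBlock_inl i j (p j) t).mp
      (h ▸ (some_mem_triplingBlock_inr p j (p j)).mpr rfl)).1
  exact absurd ((hmem 0).symm.trans (hmem 1)) (by decide)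

lemma injOn_triplingBlock {B : Fin 3 → Finset (Finset (Option (Fin n)))}
    (hB : ∀ i, ∀ t ∈ B i, t.card = 3) (R : Finset (Fin 3 → Fin n)) :
    Set.InjOn triplingBlock ((Finset.univ.sigma B).disjSum R :
      Set ((Σ _ : Fin 3, Finset (Option (Fin n))) ⊕ (Fin 3 → Fin n))) := by
  rintro (⟨i, t⟩ | p) hd (⟨j, u⟩ | q) - h
  · obtain ⟨y, hy⟩ := exists_some_mem_of_card_eq_three (hB i t (by simpa using hd))
    obtain rfl : j = i := ((some_mem_triplingBlock_inl j i y u).mp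
      (h ▸ (some_mem_triplingBlock_inl i i y t).mpr ⟨rfl, hy⟩)).1
    rw [Finset.image_injective (Option.map_injective (Prod.mk_right_injective j)) h]
  · exact (triplingBlock_inl_ne_inr h).elim
  · exact (triplingBlock_inl_ne_inr h.symm).elim
  · congr 1
    funext j
    exact ((some_mem_triplingBlock_inr q j (p j)).mp
      (h ▸ (some_mem_triplingBlock_inr p j (p j)).mpr rfl)).symm

lemma tripling_inter {B C : Fin 3 → Finset (Finset (Option (Fin n)))}
    (hB : ∀ i, ∀ t ∈ B i, t.card = 3) (hC : ∀ i, ∀ t ∈ C i, t.card = 3)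
    (R S : Finset (Fin 3 → Fin n)) :
    tripling B R ∩ tripling C S = tripling (fun i => B i ∩ C i) (R ∩ S) := by
  have hBC : ∀ i, ∀ t ∈ B i ∪ C i, t.card = 3 := fun i t ht =>
    (Finset.mem_union.mp ht).elim (hB i t) (hC i t)
  rw [tripling, tripling, ← Finset.image_inter_of_injOn, tripling]
  · congr 1
    ext (⟨i, t⟩ | p) <;> simp
  · refine (injOn_triplingBlock hBC (R ∪ S)).mono ?_
    rintro (⟨i, t⟩ | p) <;> simp

lemma card_tripling {B : Fin 3 → Finset (Finset (Option (Fin n)))}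
    (hB : ∀ i, ∀ t ∈ B i, t.card = 3) (R : Finset (Fin 3 → Fin n)) :
    (tripling B R).card = ∑ i, (B i).card + R.card := by
  rw [tripling, Finset.card_image_of_injOn (injOn_triplingBlock hB R), Finset.card_disjSum,
    Finset.card_sigma]

lemma filter_none_mem_tripling (B : Fin 3 → Finset (Finset (Option (Fin n))))
    (R : Finset (Fin 3 → Fin n)) :
    (tripling B R).filter (none ∈ ·) = tripling (fun i => (B i).filter (none ∈ ·)) ∅ := by
  rw [tripling, Finset.filter_image, tripling]
  congr 1
  ext (⟨i, t⟩ | p)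
  · simp [none_mem_triplingBlock_inl]
  · simp [none_notMem_triplingBlock_inr]

lemma IsSteiner.tripling {B : Fin 3 → Finset (Finset (Option (Fin n)))}
    {R : Finset (Fin 3 → Fin n)} (hB : ∀ i, IsSteiner (B i))
    (hR : ∀ i j, i ≠ j → ∀ x y, ∃! p, p ∈ R ∧ p i = x ∧ p j = y) :
    IsSteiner (tripling B R) := by
  refine ⟨?_, fun a b hab => ?_⟩
  · simp only [_root_.tripling, Finset.mem_image]
    rintro _ ⟨⟨i, t⟩ | p, hd, rfl⟩
    · rw [card_triplingBlock_inl]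
      exact (hB i).1 t (by simpa using hd)
    · exact card_triplingBlock_inr p
  suffices h : ∃! d, d ∈ (Finset.univ.sigma B).disjSum R ∧
      a ∈ triplingBlock d ∧ b ∈ triplingBlock d by
    obtain ⟨d, ⟨hd, ha, hb⟩, huniq⟩ := h
    refine ⟨triplingBlock d, ⟨Finset.mem_image_of_mem _ hd, ha, hb⟩, ?_⟩
    rintro u ⟨hu, hau, hbu⟩
    obtain ⟨d', hd', rfl⟩ := Finset.mem_image.mp hu
    rw [huniq d' ⟨hd', hau, hbu⟩]
  have inside (i : Fin 3) (a' b' : Option (Fin n)) (hab' : a' ≠ b')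
      (ha : ∀ j t, a ∈ triplingBlock (.inl ⟨j, t⟩) ∧ b ∈ triplingBlock (.inl ⟨j, t⟩) ↔
        i = j ∧ a' ∈ t ∧ b' ∈ t)
      (hp : ∀ p : Fin 3 → Fin n, ¬ (a ∈ triplingBlock (.inr p) ∧ b ∈ triplingBlock (.inr p))) :
      ∃! d, d ∈ (Finset.univ.sigma B).disjSum R ∧
        a ∈ triplingBlock d ∧ b ∈ triplingBlock d := by
    obtain ⟨t, ⟨ht, hat, hbt⟩, huniq⟩ := (hB i).2 a' b' hab'
    refine ⟨.inl ⟨i, t⟩, ⟨by simpa using ht, (ha i t).mpr ⟨rfl, hat, hbt⟩⟩, ?_⟩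
    rintro (⟨j, u⟩ | p) ⟨hd, hmem⟩
    · obtain ⟨rfl, hu⟩ := (ha j u).mp hmem
      rw [huniq u ⟨by simpa using hd, hu⟩]
    · exact (hp p hmem).elim
  rcases a with _ | ⟨i, x⟩ <;> rcases b with _ | ⟨j, y⟩
  · exact absurd rfl hab
  · refine inside j none (some y) (by simp) (fun k t => ?_) fun p hp =>
      none_notMem_triplingBlock_inr p hp.1
    rw [none_mem_triplingBlock_inl, some_mem_triplingBlock_inl]
    tauto
  · refine inside i (some x) none (by simp) (fun k t => ?_) fun p hp =>
      none_notMem_triplingBlock_inr p hp.2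
    rw [none_mem_triplingBlock_inl, some_mem_triplingBlock_inl]
    tauto
  · by_cases hij : i = j
    · subst hij
      have hxy : x ≠ y := fun h => hab (by rw [h])
      refine inside i (some x) (some y) (by simpa using hxy) (fun k t => ?_) fun p hp => ?_
      · rw [some_mem_triplingBlock_inl, some_mem_triplingBlock_inl]
        tauto
      · simp only [some_mem_triplingBlock_inr] at hp
        exact hxy (hp.1.symm.trans hp.2)
    · obtain ⟨p, ⟨hp, hx, hy⟩, huniq⟩ := hR i j hij x y
      refine ⟨.inr p, ⟨by simpa using hp, ?_⟩, ?_⟩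
      · simp only [some_mem_triplingBlock_inr]
        exact ⟨hx, hy⟩
      · rintro (⟨k, t⟩ | q) ⟨hd, ha, hb⟩
        · rw [some_mem_triplingBlock_inl] at ha hb
          exact (hij (ha.1.symm.trans hb.1)).elim
        · rw [some_mem_triplingBlock_inr] at ha hb
          rw [huniq q ⟨by simpa using hd, ha, hb⟩]

/-- The (row, column, symbol) triples of a square array. -/
def latinTriples (L : Fin n → Fin n → Fin n) : Finset (Fin 3 → Fin n) :=
  Finset.univ.filter fun p => L (p 0) (p 1) = p 2

lemma IsLatin.existsUnique_mem_latinTriples {L : Fin n → Fin n → Fin n} (hL : IsLatin n L)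
    (i j : Fin 3) (hij : i ≠ j) (x y : Fin n) :
    ∃! p, p ∈ latinTriples L ∧ p i = x ∧ p j = y := by
  have hrow (x z : Fin n) : ∃ y, L x y = z := Finite.surjective_of_injective (hL.1 x) z
  have hcol (y z : Fin n) : ∃ x, L x y = z := Finite.surjective_of_injective (hL.2 y) z
  have hcell (x y : Fin n) : ∃ p ∈ latinTriples L, p 0 = x ∧ p 1 = y ∧ p 2 = L x y :=
    ⟨![x, y, L x y], by simp [latinTriples], rfl, rfl, rfl⟩
  have hex : ∃ p, p ∈ latinTriples L ∧ p i = x ∧ p j = y := by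
    fin_cases i <;> fin_cases j <;> first | exact absurd rfl hij | skip
    · obtain ⟨p, hp, h0, h1, h2⟩ := hcell x y
      exact ⟨p, hp, h0, h1⟩
    · obtain ⟨z, hz⟩ := hrow x y
      obtain ⟨p, hp, h0, h1, h2⟩ := hcell x z
      exact ⟨p, hp, h0, h2.trans hz⟩
    · obtain ⟨p, hp, h0, h1, h2⟩ := hcell y x
      exact ⟨p, hp, h1, h0⟩
    · obtain ⟨z, hz⟩ := hcol x y
      obtain ⟨p, hp, h0, h1, h2⟩ := hcell z x
      exact ⟨p, hp, h1, h2.trans hz⟩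
    · obtain ⟨z, hz⟩ := hrow y x
      obtain ⟨p, hp, h0, h1, h2⟩ := hcell y z
      exact ⟨p, hp, h2.trans hz, h0⟩
    · obtain ⟨z, hz⟩ := hcol y x
      obtain ⟨p, hp, h0, h1, h2⟩ := hcell z y
      exact ⟨p, hp, h2.trans hz, h1⟩
  refine existsUnique_of_exists_of_unique hex ?_
  rintro p q ⟨hp, hpx, hpy⟩ ⟨hq, hqx, hqy⟩
  have hi : p i = q i := hpx.trans hqx.symm
  have hj : p j = q j := hpy.trans hqy.symm
  simp only [latinTriples, Finset.mem_filter, Finset.mem_univ, true_and] at hp hq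
  have h01 (h0 : p 0 = q 0) (h1 : p 1 = q 1) : p = q := by
    have h2 : p 2 = q 2 := by rw [← hp, ← hq, h0, h1]
    funext k
    fin_cases k <;> assumption
  have h02 (h0 : p 0 = q 0) (h2 : p 2 = q 2) : p = q :=
    h01 h0 (hL.1 (p 0) (by rw [hp, h2, h0, hq]))
  have h12 (h1 : p 1 = q 1) (h2 : p 2 = q 2) : p = q :=
    h01 (hL.2 (p 1) (by simp only [hp, h2]; rw [h1, hq])) h1
  fin_cases i <;> fin_cases j <;> first | exact absurd rfl hij | skip
  exacts [h01 hi hj, h02 hi hj, h01 hj hi, h12 hi hj, h02 hj hi, h12 hj hi]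

lemma latinTriples_inter {L M : Fin n → Fin n → Fin n} :
    latinTriples L ∩ latinTriples M =
      (Finset.univ.filter fun c : Fin n × Fin n => L c.1 c.2 = M c.1 c.2).image
        fun c => ![c.1, c.2, L c.1 c.2] := by
  ext p
  simp only [latinTriples, Finset.mem_inter, Finset.mem_filter, Finset.mem_univ, true_and,
    Finset.mem_image, Prod.exists]
  constructor
  · rintro ⟨hL, hM⟩
    refine ⟨p 0, p 1, hL.trans hM.symm, ?_⟩
    funext k
    fin_cases k <;> simp [hL]
  · rintro ⟨x, y, h, rfl⟩
    simp [h]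

lemma card_latinTriples_inter {L M : Fin n → Fin n → Fin n} :
    (latinTriples L ∩ latinTriples M).card =
      (Finset.univ.filter fun c : Fin n × Fin n => L c.1 c.2 = M c.1 c.2).card := by
  rw [latinTriples_inter, Finset.card_image_of_injective]
  intro c d h
  exact Prod.ext (congrFun h 0) (congrFun h 1)

lemma exists_latinTriples_of_mem_J3L {b : ℕ} (hb : b ∈ J3L n) :
    ∃ L₁ L₂ L₃ : Fin n → Fin n → Fin n, IsLatin n L₁ ∧ IsLatin n L₂ ∧ IsLatin n L₃ ∧
      latinTriples L₁ ∩ latinTriples L₂ = latinTriples L₁ ∩ latinTriples L₃ ∧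
      latinTriples L₁ ∩ latinTriples L₂ = latinTriples L₂ ∩ latinTriples L₃ ∧
      (latinTriples L₁ ∩ latinTriples L₂).card = b := by
  obtain ⟨L₁, L₂, L₃, hL₁, hL₂, hL₃, hcard, hne⟩ := hb
  have hcell (x y : Fin n) : (L₁ x y = L₂ x y ∧ L₂ x y = L₃ x y) ∨
      (L₁ x y ≠ L₂ x y ∧ L₁ x y ≠ L₃ x y ∧ L₂ x y ≠ L₃ x y) := by
    by_cases h : L₁ x y = L₂ x y ∧ L₂ x y = L₃ x y
    · exact .inl h
    · exact .inr (hne (x, y) (by simpa [agreeCells] using h))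
  refine ⟨L₁, L₂, L₃, hL₁, hL₂, hL₃, ?_, ?_, ?_⟩
  · ext p
    simp only [latinTriples, Finset.mem_inter, Finset.mem_filter, Finset.mem_univ, true_and]
    have := hcell (p 0) (p 1)
    grind
  · ext p
    simp only [latinTriples, Finset.mem_inter, Finset.mem_filter, Finset.mem_univ, true_and]
    have := hcell (p 0) (p 1)
    grind
  · rw [card_latinTriples_inter, ← hcard, agreeCells]
    congr 1
    ext c
    simp only [Finset.mem_filter, Finset.mem_univ, true_and]
    have := hcell c.1 c.2
    grind

lemma SharesFlower.tripling {B₁ B₂ B₃ : Fin 3 → Finset (Finset (Option (Fin n)))}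
    {k s : Fin 3 → ℕ} (hB : ∀ i, SharesFlower none (k i) (s i) (B₁ i) (B₂ i) (B₃ i))
    {L₁ L₂ L₃ : Fin n → Fin n → Fin n}
    (hL₁ : IsLatin n L₁) (hL₂ : IsLatin n L₂) (hL₃ : IsLatin n L₃)
    (h₁₃ : latinTriples L₁ ∩ latinTriples L₂ = latinTriples L₁ ∩ latinTriples L₃)
    (h₂₃ : latinTriples L₁ ∩ latinTriples L₂ = latinTriples L₂ ∩ latinTriples L₃) :
    SharesFlower none (∑ i, k i + (latinTriples L₁ ∩ latinTriples L₂).card) (∑ i, s i)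
      (tripling B₁ (latinTriples L₁)) (tripling B₂ (latinTriples L₂))
      (tripling B₃ (latinTriples L₃)) := by
  choose hB₁ hB₂ hB₃ hB₁₃ hB₂₃ hk hf₂ hf₃ hs using hB
  have c₁ i := (hB₁ i).1
  have c₂ i := (hB₂ i).1
  have c₃ i := (hB₃ i).1
  refine ⟨.tripling hB₁ hL₁.existsUnique_mem_latinTriples,
    .tripling hB₂ hL₂.existsUnique_mem_latinTriples,
    .tripling hB₃ hL₃.existsUnique_mem_latinTriples, ?_, ?_, ?_, ?_, ?_, ?_⟩
  · simp only [tripling_inter c₁ c₂, tripling_inter c₁ c₃, hB₁₃, h₁₃]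
  · simp only [tripling_inter c₁ c₂, tripling_inter c₂ c₃, hB₂₃, h₂₃]
  · rw [tripling_inter c₁ c₂, card_tripling fun i t ht => c₁ i t (Finset.mem_inter.mp ht).1]
    simp only [hk]
  · simp only [filter_none_mem_tripling, hf₂]
  · simp only [filter_none_mem_tripling, hf₃]
  · rw [filter_none_mem_tripling,
      card_tripling fun i t ht => c₁ i t (Finset.mem_filter.mp ht).1]
    simp only [hs, Finset.card_empty, add_zero]

end Tripling

/-- For all admissible `r`, if `b ∈ J'³(2r)` and `a₁, a₂, a₃ ∈ J³_F(r)`,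
then `a₁ + a₂ + a₃ + b ∈ J³_F(3r)`. -/
theorem stmt4 (r : ℕ) (hadm : r % 3 = 0 ∨ r % 3 = 1) (b a₁ a₂ a₃ : ℕ)
    (hb : b ∈ J3L (2 * r))
    (h₁ : a₁ ∈ J3F r) (h₂ : a₂ ∈ J3F r) (h₃ : a₃ ∈ J3F r) :
    a₁ + a₂ + a₃ + b ∈ J3F (3 * r) := by
  obtain ⟨L₁, L₂, L₃, hL₁, hL₂, hL₃, h₁₃, h₂₃, hcard⟩ := exists_latinTriples_of_mem_J3L hb
  have h (i : Fin 3) : ![a₁, a₂, a₃] i ∈ J3F r := by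
    fin_cases i <;> assumption
  choose B₁ B₂ B₃ hB using fun i => exists_sharesFlower_of_mem_J3F (h i)
  have key := SharesFlower.tripling hB hL₁ hL₂ hL₃ h₁₃ h₂₃
  refine mem_J3F_of_sharesFlower (x := none) (B₁ := tripling B₁ (latinTriples L₁))
    (B₂ := tripling B₂ (latinTriples L₂)) (B₃ := tripling B₃ (latinTriples L₃)) ?_ ?_
  · simp only [Fintype.card_option, Fintype.card_prod, Fintype.card_fin]
    ring
  · convert key using 1
    · simp [Fin.sum_univ_three, hcard]
      ring
    · simp
end

section
/- If r ≡ 0 or 1 (mod 3), there exists a pairwise balanced design B({k₁, k₂, …, k_x}, 1, r), and for each 1 ≤ i ≤ x there exists a Steiner triple system STS(2kᵢ + 1), then there exists a Steiner triple system STS(2r + 1). -/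
/-- A totally symmetric idempotent operation, i.e. a Steiner quasigroup. -/
structure IsSteinerQuasigroup {V : Type*} (f : V → V → V) : Prop where
  idem : ∀ x, f x x = x
  comm : ∀ x y, f x y = f y x
  cancel : ∀ x y, f x (f x y) = y

namespace IsSteinerQuasigroup

variable {V W : Type*} {f : V → V → V}

theorem ne_left (hf : IsSteinerQuasigroup f) {x y : V} (h : x ≠ y) : f x y ≠ x := by
  intro h'
  have := hf.cancel x y
  rw [h', hf.idem] at this
  exact h this

theorem ne_right (hf : IsSteinerQuasigroup f) {x y : V} (h : x ≠ y) : f x y ≠ y := by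
  rw [hf.comm]
  exact hf.ne_left h.symm

theorem cancel_right (hf : IsSteinerQuasigroup f) (x y : V) : f y (f x y) = x := by
  rw [hf.comm x y, hf.cancel]

theorem transport (hf : IsSteinerQuasigroup f) (e : V ≃ W) :
    IsSteinerQuasigroup fun x y => e (f (e.symm x) (e.symm y)) where
  idem x := by simp [hf.idem]
  comm x y := by simp [hf.comm (e.symm x)]
  cancel x y := by simp [hf.cancel]

theorem exists_isSTS {v : ℕ} {f : Fin v → Fin v → Fin v} (hf : IsSteinerQuasigroup f) :
    ∃ B : Finset (Finset (Fin v)), IsSTS v B := by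
  classical
  refine ⟨Finset.univ.filter fun t => ∃ x y, x ≠ y ∧ t = {x, y, f x y}, ?_, ?_⟩
  · intro b hb
    obtain ⟨x, y, hxy, rfl⟩ := (Finset.mem_filter.1 hb).2
    exact Finset.card_eq_three.2
      ⟨x, y, f x y, hxy, (hf.ne_left hxy).symm, (hf.ne_right hxy).symm, rfl⟩
  · intro p hp
    obtain ⟨a, b, hab, rfl⟩ := Finset.card_eq_two.1 hp
    refine ⟨{a, b, f a b}, ⟨?_, ?_⟩, ?_⟩
    · simp only [Finset.mem_filter, Finset.mem_univ, true_and]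
      exact ⟨a, b, hab, rfl⟩
    · grind
    · rintro t ⟨ht, hsub⟩
      obtain ⟨x, y, hxy, rfl⟩ := (Finset.mem_filter.1 ht).2
      have ha : a ∈ ({x, y, f x y} : Finset (Fin v)) := hsub (by simp)
      have hb : b ∈ ({x, y, f x y} : Finset (Fin v)) := hsub (by simp)
      have h1 := hf.cancel x y
      have h2 := hf.cancel_right x y
      have h3 := hf.comm x y
      have h4 := hf.comm x (f x y)
      have h5 := hf.comm y (f x y)
      simp only [Finset.mem_insert, Finset.mem_singleton] at ha hb
      ext z
      simp only [Finset.mem_insert, Finset.mem_singleton]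
      rcases ha with rfl | rfl | rfl <;> rcases hb with rfl | rfl | rfl <;> grind

end IsSteinerQuasigroup

theorem IsSTS.exists_isSteinerQuasigroup {v : ℕ} {B : Finset (Finset (Fin v))} (hB : IsSTS v B) :
    ∃ f : Fin v → Fin v → Fin v, IsSteinerQuasigroup f := by
  classical
  have huniq : ∀ x y : Fin v, x ≠ y → ∀ s ∈ B, ∀ t ∈ B, x ∈ s → y ∈ s → x ∈ t → y ∈ t → s = t := by
    intro x y hxy s hs t ht hxs hys hxt hyt
    exact (hB.2 {x, y} (Finset.card_pair hxy)).unique ⟨hs, by grind⟩ ⟨ht, by grind⟩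
  have hex : ∀ x y : Fin v, x ≠ y → ∃ z, z ≠ x ∧ z ≠ y ∧ {x, y, z} ∈ B := by
    intro x y hxy
    obtain ⟨b, ⟨hb, hsub⟩, -⟩ := hB.2 {x, y} (Finset.card_pair hxy)
    have hc : (b \ {x, y}).card = 1 := by
      rw [Finset.card_sdiff_of_subset hsub, hB.1 b hb, Finset.card_pair hxy]
    obtain ⟨z, hz⟩ := Finset.card_eq_one.1 hc
    have hzb : z ∈ b \ {x, y} := by simp [hz]
    have hbe : {x, y, z} = b := by
      rw [← Finset.sdiff_union_of_subset hsub, hz]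
      ext w
      simp only [Finset.mem_insert, Finset.mem_singleton, Finset.mem_union]
      tauto
    refine ⟨z, ?_, ?_, hbe ▸ hb⟩ <;> grind
  choose! g hgx hgy hg using hex
  have hval : ∀ x y z, x ≠ y → z ≠ x → z ≠ y → {x, y, z} ∈ B → g x y = z := by
    intro x y z hxy hzx hzy hz
    have h := huniq x y hxy _ (hg x y hxy) _ hz (by simp) (by simp) (by simp) (by simp)
    have : g x y ∈ ({x, y, z} : Finset (Fin v)) := by rw [← h]; simp
    have h1 := hgx x y hxy
    have h2 := hgy x y hxy
    grind
  refine ⟨fun x y => if x = y then x else g x y, ⟨by simp, ?_, ?_⟩⟩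
  · intro x y
    by_cases hxy : x = y
    · simp [hxy]
    · simp only [hxy, Ne.symm hxy, if_false]
      refine hval x y _ hxy (hgy y x (Ne.symm hxy)) (hgx y x (Ne.symm hxy)) ?_
      rw [Finset.insert_comm]
      exact hg y x (Ne.symm hxy)
  · intro x y
    by_cases hxy : x = y
    · simp [hxy]
    · simp only [hxy, if_false, (hgx x y hxy).symm]
      refine hval x _ y (hgx x y hxy).symm (Ne.symm hxy) (hgy x y hxy).symm ?_
      rw [Finset.pair_comm]
      exact hg x y hxy

/-- The involution of `Option (R × Bool)` fixing the point at infinity and swapping the two copies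
of each point of `R`. -/
def flipPoint {R : Type*} : Option (R × Bool) → Option (R × Bool)
  | none => none
  | some (i, s) => some (i, !s)

/-- The points of `Option (R × Bool)` lying over the set `b`, with the point at infinity. -/
def doubled {R : Type*} (b : Finset R) : Set (Option (R × Bool)) :=
  {p | ∀ q ∈ p, q.1 ∈ b}

@[simp] theorem none_mem_doubled {R : Type*} (b : Finset R) : none ∈ doubled b := by
  simp [doubled]

@[simp] theorem some_mem_doubled {R : Type*} (b : Finset R) (i : R) (s : Bool) :
    some (i, s) ∈ doubled b ↔ i ∈ b := by
  simp only [doubled, Option.mem_some_iff, Set.mem_ofPred_eq, forall_eq']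

/-- The points of an `STS(2k+1)` can be labelled by `doubled b`, for any `k`-set `b`, so that
the flower at `0` becomes the standard one. -/
theorem IsSteinerQuasigroup.exists_labelling {R : Type*} {k : ℕ}
    {f : Fin (2 * k + 1) → Fin (2 * k + 1) → Fin (2 * k + 1)} (hf : IsSteinerQuasigroup f)
    {b : Finset R} (hb : b.card = k) :
    ∃ ι : Fin (2 * k + 1) → Option (R × Bool), Function.Injective ι ∧ Set.range ι = doubled b ∧
      ι 0 = none ∧ ∀ x, ι (f 0 x) = flipPoint (ι x) := by
  classical
  set T : Finset (Fin (2 * k + 1)) := Finset.univ.filter fun x => x ≠ 0 ∧ x < f 0 x with hT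
  have hinv : ∀ x, f 0 (f 0 x) = x := hf.cancel 0
  have h0 : f 0 0 = 0 := hf.idem 0
  have hne : ∀ x, x ≠ 0 → f 0 x ≠ x := fun x hx => hf.ne_right hx.symm
  have hne0 : ∀ x, x ≠ 0 → f 0 x ≠ 0 := fun x hx => hf.ne_left hx.symm
  have hmem : ∀ x, x ∈ T ↔ x ≠ 0 ∧ x < f 0 x := by simp [hT]
  have hcard : T.card = b.card := by
    have hinj : Function.Injective (f 0) := fun x y h => by rw [← hinv x, h, hinv]
    have h1 : (Finset.univ : Finset (Fin (2 * k + 1))).erase 0 = T ∪ T.image (f 0) := by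
      ext x
      simp only [Finset.mem_erase, Finset.mem_univ, and_true, Finset.mem_union, Finset.mem_image,
        hmem]
      constructor
      · intro hx
        rcases lt_or_gt_of_ne (hne x hx) with h | h
        · exact Or.inr ⟨f 0 x, ⟨hne0 x hx, by rwa [hinv]⟩, hinv x⟩
        · exact Or.inl ⟨hx, h⟩
      · rintro (h | ⟨y, h, rfl⟩)
        · exact h.1
        · exact hne0 y h.1
    have h2 : Disjoint T (T.image (f 0)) := by
      rw [Finset.disjoint_left]
      intro x hx hx'
      obtain ⟨y, hy, rfl⟩ := Finset.mem_image.1 hx'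
      rw [hmem] at hx hy
      rw [hinv] at hx
      exact lt_asymm hx.2 hy.2
    have h3 := congrArg Finset.card h1
    rw [Finset.card_union_of_disjoint h2, Finset.card_image_of_injective _ hinj,
      Finset.card_erase_of_mem (Finset.mem_univ _), Finset.card_univ, Fintype.card_fin] at h3
    omega
  let e : T ≃ b := Finset.equivOfCardEq hcard
  have hT' : ∀ x, x ≠ 0 → x ∉ T → f 0 x ∈ T := by
    intro x hx hxT
    rw [hmem] at hxT ⊢
    refine ⟨hne0 x hx, ?_⟩
    rw [hinv]
    exact lt_of_le_of_ne (not_lt.1 fun h => hxT ⟨hx, h⟩) (hne x hx)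
  have hT'' : ∀ x, x ∈ T → f 0 x ∉ T := by
    intro x hx hx'
    rw [hmem] at hx hx'
    rw [hinv] at hx'
    exact lt_asymm hx.2 hx'.2
  have hT0 : (0 : Fin (2 * k + 1)) ∉ T := by simp [hmem]
  let ι : Fin (2 * k + 1) → Option (R × Bool) := fun x =>
    if h : x ∈ T then some ((e ⟨x, h⟩ : R), false)
    else if h' : f 0 x ∈ T then some ((e ⟨f 0 x, h'⟩ : R), true) else none
  have hι0 : ι 0 = none := by simp [ι, h0, hT0]
  have hι1 : ∀ x (h : x ∈ T), ι x = some ((e ⟨x, h⟩ : R), false) := fun x h => by simp [ι, h]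
  have hι2 : ∀ x (h : x ∈ T), ι (f 0 x) = some ((e ⟨x, h⟩ : R), true) := fun x h => by
    simp [ι, hT'' x h, hinv, h]
  have hcases : ∀ x, x = 0 ∨ x ∈ T ∨ ∃ y ∈ T, x = f 0 y := by
    intro x
    by_cases hx : x = 0
    · exact Or.inl hx
    by_cases hxT : x ∈ T
    · exact Or.inr (Or.inl hxT)
    · exact Or.inr (Or.inr ⟨f 0 x, hT' x hx hxT, (hinv x).symm⟩)
  refine ⟨ι, ?_, ?_, hι0, ?_⟩
  · intro x y hxy
    rcases hcases x with rfl | hx | ⟨x, hx, rfl⟩ <;> rcases hcases y with rfl | hy | ⟨y, hy, rfl⟩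
    · rfl
    · simp [hι0, hι1 y hy] at hxy
    · simp [hι0, hι2 y hy] at hxy
    · simp [hι0, hι1 x hx] at hxy
    · simpa [hι1 x hx, hι1 y hy, Subtype.ext_iff] using hxy
    · simp [hι1 x hx, hι2 y hy] at hxy
    · simp [hι0, hι2 x hx] at hxy
    · simp [hι2 x hx, hι1 y hy] at hxy
    · simp only [hι2 x hx, hι2 y hy, Option.some.injEq, Prod.mk.injEq, and_true] at hxy
      have := e.injective (Subtype.ext hxy)
      rw [Subtype.mk.inj this]
  · ext p
    constructor
    · rintro ⟨x, rfl⟩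
      rcases hcases x with rfl | hx | ⟨x, hx, rfl⟩
      · simp [hι0]
      · simp [hι1 x hx]
      · simp [hι2 x hx]
    · intro hp
      rcases p with _ | ⟨i, s⟩
      · exact ⟨0, hι0⟩
      · rw [some_mem_doubled] at hp
        obtain ⟨⟨x, hx⟩, hxe⟩ := e.surjective ⟨i, hp⟩
        cases s
        · exact ⟨x, by simp [hι1 x hx, hxe]⟩
        · exact ⟨f 0 x, by simp [hι2 x hx, hxe]⟩
  · intro x
    rcases hcases x with rfl | hx | ⟨x, hx, rfl⟩
    · simp [h0, hι0, flipPoint]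
    · simp [hι1 x hx, hι2 x hx, flipPoint]
    · simp [hinv, hι1 x hx, hι2 x hx, flipPoint]

/-- A Steiner quasigroup on `doubled b` whose lines through infinity are the standard ones. -/
structure IsLocalSteiner {R : Type*} (b : Finset R)
    (g : Option (R × Bool) → Option (R × Bool) → Option (R × Bool)) : Prop where
  mem : ∀ p ∈ doubled b, ∀ q ∈ doubled b, g p q ∈ doubled b
  idem : ∀ p ∈ doubled b, g p p = p
  comm : ∀ p ∈ doubled b, ∀ q ∈ doubled b, g p q = g q p
  cancel : ∀ p ∈ doubled b, ∀ q ∈ doubled b, g p (g p q) = q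
  infty : ∀ p ∈ doubled b, g none p = flipPoint p

theorem IsSteinerQuasigroup.exists_isLocalSteiner {R : Type*} {k : ℕ}
    {f : Fin (2 * k + 1) → Fin (2 * k + 1) → Fin (2 * k + 1)} (hf : IsSteinerQuasigroup f)
    {b : Finset R} (hb : b.card = k) : ∃ g, IsLocalSteiner b g := by
  obtain ⟨ι, hinj, hrange, h0, hflip⟩ := hf.exists_labelling hb
  have hl : ∀ x, Function.invFun ι (ι x) = x := Function.leftInverse_invFun hinj
  refine ⟨fun p q => ι (f (Function.invFun ι p) (Function.invFun ι q)), ?_, ?_, ?_, ?_, ?_⟩ <;>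
    rw [← hrange]
  · rintro _ ⟨x, rfl⟩ _ ⟨y, rfl⟩
    exact ⟨_, rfl⟩
  · rintro _ ⟨x, rfl⟩
    simp [hl, hf.idem]
  · rintro _ ⟨x, rfl⟩ _ ⟨y, rfl⟩
    simp [hl, hf.comm x y]
  · rintro _ ⟨x, rfl⟩ _ ⟨y, rfl⟩
    simp [hl, hf.cancel]
  · rintro _ ⟨x, rfl⟩
    rw [← h0]
    simp [hl, hflip]

/-- Two finite points over distinct points of `b` determine a third point over another point
of `b`. -/
theorem IsLocalSteiner.exists_third {R : Type*} {b : Finset R}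
    {g : Option (R × Bool) → Option (R × Bool) → Option (R × Bool)} (hg : IsLocalSteiner b g)
    {i j : R} (hi : i ∈ b) (hj : j ∈ b) (hij : i ≠ j) (s t : Bool) :
    ∃ l u, l ∈ b ∧ l ≠ i ∧ g (some (i, s)) (some (j, t)) = some (l, u) := by
  have hp : some (i, s) ∈ doubled b := by simpa
  have hp' : some (i, !s) ∈ doubled b := by simpa
  have hq : some (j, t) ∈ doubled b := by simpa
  have hm := hg.mem _ hp _ hq
  have hc := hg.cancel _ hp _ hq
  have hn : g (some (i, s)) none = some (i, !s) := by
    rw [hg.comm _ hp _ (by simp), hg.infty _ hp]; rfl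
  rcases h : g (some (i, s)) (some (j, t)) with _ | ⟨l, u⟩
  · rw [h, hn] at hc
    exact absurd (by simpa using congrArg (Option.map Prod.fst) hc) hij
  · rw [h] at hm hc
    refine ⟨l, u, by simpa using hm, ?_, rfl⟩
    rintro rfl
    by_cases hu : u = s
    · subst hu
      rw [hg.idem _ hp] at hc
      exact hij (by simpa using congrArg (Option.map Prod.fst) hc)
    · have hu' : u = !s := by cases u <;> cases s <;> simp_all
      have := hg.cancel _ hp none (by simp)
      rw [hn, ← hu', hc] at this
      simp at this

/-- Gluing along a pairwise balanced design: `blk i j` is the block through `i` and `j`. -/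
theorem exists_isSteinerQuasigroup_of_blocks {R : Type*} (blk : R → R → Finset R)
    (hl : ∀ i j, i ≠ j → i ∈ blk i j) (hcomm : ∀ i j, blk i j = blk j i)
    (hblk : ∀ i j l, i ≠ j → l ≠ i → l ∈ blk i j → blk i l = blk i j)
    (hloc : ∀ i j, i ≠ j → ∃ g, IsLocalSteiner (blk i j) g) :
    ∃ F : Option (R × Bool) → Option (R × Bool) → Option (R × Bool), IsSteinerQuasigroup F := by
  classical
  have hloc' : ∀ b : Finset R, ∃ g, (∃ i j, i ≠ j ∧ b = blk i j) → IsLocalSteiner b g := by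
    intro b
    by_cases h : ∃ i j, i ≠ j ∧ b = blk i j
    · obtain ⟨i, j, hij, rfl⟩ := h
      obtain ⟨g, hg⟩ := hloc i j hij
      exact ⟨g, fun _ => hg⟩
    · exact ⟨fun p _ => p, fun h' => absurd h' h⟩
  choose G hG using hloc'
  have hr : ∀ i j, i ≠ j → j ∈ blk i j := fun i j h => hcomm j i ▸ hl j i h.symm
  let F : Option (R × Bool) → Option (R × Bool) → Option (R × Bool)
    | none, q => flipPoint q
    | p, none => flipPoint p
    | some (i, s), some (j, t) =>
      if i = j then (if s = t then some (i, s) else none)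
      else G (blk i j) (some (i, s)) (some (j, t))
  have hF1 : ∀ q, F none q = flipPoint q := fun q => by cases q <;> rfl
  have hF2 : ∀ p, F p none = flipPoint p := fun p => by cases p <;> rfl
  have hF3 : ∀ i s j t, F (some (i, s)) (some (j, t)) =
      if i = j then (if s = t then some (i, s) else none)
      else G (blk i j) (some (i, s)) (some (j, t)) := fun _ _ _ _ => rfl
  refine ⟨F, ⟨?_, ?_, ?_⟩⟩
  · rintro (_ | ⟨i, s⟩)
    · rfl
    · simp [hF3]
  · rintro (_ | ⟨i, s⟩) (_ | ⟨j, t⟩)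
    · rfl
    · rfl
    · rfl
    · rw [hF3, hF3]
      by_cases hij : i = j
      · subst hij
        by_cases hst : s = t
        · simp [hst]
        · simp [hst, Ne.symm hst]
      · rw [if_neg hij, if_neg (Ne.symm hij), hcomm j i]
        exact (hG _ ⟨i, j, hij, rfl⟩).comm _ (by simpa using hl i j hij) _
          (by simpa using hr i j hij)
  · rintro (_ | ⟨i, s⟩) (_ | ⟨j, t⟩)
    · rfl
    · simp [hF1, flipPoint]
    · simp [hF2, hF3, flipPoint]
    · by_cases hij : i = j
      · subst hij
        by_cases hst : s = t
        · simp [hF3, hst]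
        · have : (!s) = t := by cases s <;> cases t <;> simp_all
          simp [hF3, hst, hF2, flipPoint, this]
      · have hg := hG _ ⟨i, j, hij, rfl⟩
        have hi := hl i j hij
        have hj := hr i j hij
        obtain ⟨l, u, hlb, hli, he⟩ := hg.exists_third hi hj hij s t
        rw [hF3, if_neg hij, he, hF3, if_neg hli.symm, hblk i j l hij hli hlb, ← he]
        exact hg.cancel _ (by simpa using hi) _ (by simpa using hj)

/-- If `r ≡ 0, 1 (mod 3)`, there exists a PBD `B({k₁, …, k_x}, 1, r)`,
and for each `i` there exists an `STS(2kᵢ+1)`, then there exists an `STS(2r+1)`. -/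
theorem stmt8 (r x : ℕ) (hr : r % 3 = 0 ∨ r % 3 = 1) (k : Fin x → ℕ)
    (hPBD : ∃ A : Finset (Finset (Fin r)), IsPBD r {m | ∃ i, m = k i} A)
    (hSTS : ∀ i, ∃ B : Finset (Finset (Fin (2 * k i + 1))), IsSTS (2 * k i + 1) B) :
    ∃ B : Finset (Finset (Fin (2 * r + 1))), IsSTS (2 * r + 1) B := by
  classical
  obtain ⟨A, hA, hpair⟩ := hPBD
  have hex : ∀ p : Finset (Fin r), p.card = 2 → ∃ b, b ∈ A ∧ p ⊆ b := fun p hp => (hpair p hp).exists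
  choose! β hβA hβ using hex
  have hsub : ∀ i j : Fin r, i ≠ j → {i, j} ⊆ β {i, j} := fun i j h => hβ _ (Finset.card_pair h)
  obtain ⟨F, hF⟩ := exists_isSteinerQuasigroup_of_blocks (fun i j : Fin r => β {i, j})
    (fun i j h => hsub i j h (by simp)) (fun i j => by rw [Finset.pair_comm])
    (fun i j l hij hli hl => by
      have hil := Finset.card_pair hli.symm
      refine (hpair {i, l} hil).unique ⟨hβA _ hil, hβ _ hil⟩ ⟨hβA _ (Finset.card_pair hij), ?_⟩
      have hi : i ∈ β {i, j} := hsub i j hij (by simp)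
      grind)
    (fun i j hij => by
      obtain ⟨m, hm⟩ := hA _ (hβA _ (Finset.card_pair hij))
      obtain ⟨B, hB⟩ := hSTS m
      obtain ⟨f, hf⟩ := hB.exists_isSteinerQuasigroup
      exact hf.exists_isLocalSteiner hm)
  have e : Option (Fin r × Bool) ≃ Fin (2 * r + 1) := Fintype.equivFinOfCardEq (by simp [mul_comm])
  exact (hF.transport e).exists_isSTS
end

section
/- Let K be a set of positive integers each congruent to 0 or 1 (mod 3), and let r ≡ 0 or 1 (mod 3). If there exists a pairwise balanced design B(K, 1, r) with point set X and block collection 𝓑 such that for each block B ∈ 𝓑 some integer k_B ∈ J³_F(|B|) is chosen, then the sum over all blocks B ∈ 𝓑 of k_B belongs to J³_F(r). -/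
/-- A group divisible design of block size three on `b × Bool`, whose groups are the pairs
`{a} × Bool` for `a ∈ b`. -/
structure IsPairGDD {α : Type*} (b : Finset α) (G : Finset (Finset (α × Bool))) : Prop where
  card_eq : ∀ t ∈ G, t.card = 3
  fst_mem : ∀ t ∈ G, ∀ p ∈ t, p.1 ∈ b
  fst_injOn : ∀ t ∈ G, ∀ p ∈ t, ∀ q ∈ t, p.1 = q.1 → p = q
  exists_mem : ∀ p q : α × Bool, p.1 ∈ b → q.1 ∈ b → p.1 ≠ q.1 → ∃ t ∈ G, p ∈ t ∧ q ∈ t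
  unique : ∀ p q : α × Bool, p ≠ q → ∀ s ∈ G, ∀ t ∈ G, p ∈ s → q ∈ s → p ∈ t → q ∈ t → s = t

/-- Three group divisible designs on `b × Bool` that pairwise meet in the same `k` triples. -/
def HasPairGDDTriple {α : Type*} [DecidableEq α] (b : Finset α) (k : ℕ) : Prop :=
  ∃ (G : Fin 3 → Finset (Finset (α × Bool))) (C : Finset (Finset (α × Bool))),
    (∀ i, IsPairGDD b (G i)) ∧ (∀ i j, i ≠ j → G i ∩ G j = C) ∧ C.card = k

lemma isSTS_iff {v : ℕ} {B : Finset (Finset (Fin v))} :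
    IsSTS v B ↔ (∀ b ∈ B, b.card = 3) ∧ (∀ x y, x ≠ y → ∃ b ∈ B, x ∈ b ∧ y ∈ b) ∧
      ∀ x y, x ≠ y → ∀ s ∈ B, ∀ t ∈ B, x ∈ s → y ∈ s → x ∈ t → y ∈ t → s = t := by
  refine and_congr_right fun _ =>
    ⟨fun h => ⟨fun x y hxy => ?_, fun x y hxy s hs t ht h₁ h₂ h₃ h₄ => ?_⟩, ?_⟩
  · obtain ⟨b, ⟨hb, hp⟩, -⟩ := h {x, y} (Finset.card_pair hxy)
    exact ⟨b, hb, hp (by simp), hp (by simp)⟩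
  · refine (h {x, y} (Finset.card_pair hxy)).unique ⟨hs, ?_⟩ ⟨ht, ?_⟩ <;>
      simp [Finset.insert_subset_iff, *]
  · rintro ⟨hex, huniq⟩ p hp
    obtain ⟨x, y, hxy, rfl⟩ := Finset.card_eq_two.1 hp
    obtain ⟨b, hb, hx, hy⟩ := hex x y hxy
    refine ⟨b, ⟨hb, by simp [Finset.insert_subset_iff, *]⟩, fun c hc => ?_⟩
    exact huniq x y hxy c hc.1 b hb (hc.2 (by simp)) (hc.2 (by simp)) hx hy

/-- Three Steiner triple systems with a common flower at `x`, indexed by `Fin 3`. -/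
lemma mem_J3F_iff {r k : ℕ} :
    k ∈ J3F r ↔ ∃ (B : Fin 3 → Finset (Finset (Fin (2 * r + 1))))
      (C F : Finset (Finset (Fin (2 * r + 1)))) (x : Fin (2 * r + 1)),
      (∀ i, IsSTS (2 * r + 1) (B i)) ∧ (∀ i j, i ≠ j → B i ∩ B j = C) ∧ C.card = k + r ∧
      (∀ i, flowerAt (B i) x = F) ∧ F.card = r := by
  constructor
  · rintro ⟨B₁, B₂, B₃, x, h₁, h₂, h₃, h₁₃, h₂₃, hk, hF₂, hF₃, hF⟩
    refine ⟨![B₁, B₂, B₃], B₁ ∩ B₂, flowerAt B₁ x, x, ?_, ?_, hk, ?_, hF⟩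
    · simp [Fin.forall_fin_succ, *]
    · intro i j hij
      fin_cases i <;> fin_cases j <;> simp_all [Finset.inter_comm]
    · simp [Fin.forall_fin_succ, ← hF₂, ← hF₃]
  · rintro ⟨B, C, F, x, hB, hC, hk, hF, hr⟩
    refine ⟨B 0, B 1, B 2, x, hB 0, hB 1, hB 2, ?_, ?_, ?_, ?_, ?_, ?_⟩
    · rw [hC 0 1 (by decide), hC 0 2 (by decide)]
    · rw [hC 0 1 (by decide), hC 1 2 (by decide)]
    · rw [hC 0 1 (by decide), hk]
    · rw [hF, hF]
    · rw [hF, hF]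
    · rw [hF, hr]

/-- Label the points other than `x` by `b × Bool` so that each flower triple consists of `x`
and the two points over some element of `b`. -/
lemma exists_flower_labelling {α : Type*} {r : ℕ} {b : Finset α}
    (hb : b.card = r) {B : Finset (Finset (Fin (2 * r + 1)))} {x : Fin (2 * r + 1)}
    (hB : IsSTS (2 * r + 1) B) (hr : (flowerAt B x).card = r) :
    ∃ (g : α → Finset (Fin (2 * r + 1))) (ψ : α × Bool → Fin (2 * r + 1)),
      (∀ a ∈ b, g a ∈ flowerAt B x) ∧ (∀ p : α × Bool, p.1 ∈ b → ψ p ≠ x ∧ ψ p ∈ g p.1) ∧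
      (∀ p q : α × Bool, p.1 ∈ b → q.1 ∈ b → ψ p = ψ q → p = q) ∧
      Set.InjOn g b ∧ ∀ y, y ≠ x → ∃ p : α × Bool, p.1 ∈ b ∧ ψ p = y := by
  obtain ⟨hB3, hex, huniq⟩ := isSTS_iff.1 hB
  have hmem : ∀ f ∈ flowerAt B x, f ∈ B ∧ x ∈ f := fun f hf => by simpa [flowerAt] using hf
  obtain ⟨g, hg⟩ : ∃ g : α → Finset (Fin (2 * r + 1)), Set.BijOn g b (flowerAt B x) :=
    b.finite_toSet.exists_bijOn_of_encard_eq (by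
      simp [Set.encard_coe_eq_coe_finsetCard, hb, hr])
  have hpair : ∀ f ∈ flowerAt B x, ∃ h : Bool → Fin (2 * r + 1),
      Function.Injective h ∧ ∀ y, y ∈ f.erase x ↔ ∃ c, h c = y := by
    intro f hf
    have hc : (f.erase x).card = 2 := by
      rw [Finset.card_erase_of_mem (hmem f hf).2, hB3 f (hmem f hf).1]
    obtain ⟨u, w, huw, he⟩ := Finset.card_eq_two.1 hc
    refine ⟨fun c => if c then u else w, ?_, fun y => ?_⟩
    · intro c d; cases c <;> cases d <;> simp [huw, huw.symm]
    · rw [he]; simp [eq_comm, or_comm]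
  choose! h hinj hh using hpair
  have hg' : ∀ a ∈ b, g a ∈ flowerAt B x := fun a ha => hg.mapsTo ha
  have hψ : ∀ p : α × Bool, p.1 ∈ b → h (g p.1) p.2 ≠ x ∧ h (g p.1) p.2 ∈ g p.1 :=
    fun p hp => Finset.mem_erase.1 ((hh _ (hg' _ hp) _).2 ⟨p.2, rfl⟩)
  refine ⟨g, fun p => h (g p.1) p.2, hg', hψ, ?_, hg.injOn, ?_⟩
  · rintro ⟨a, c⟩ ⟨a', c'⟩ ha ha' heq
    dsimp only at ha ha' heq
    have h₁ := hψ (a, c) ha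
    have h₂ := hψ (a', c') ha'
    dsimp only at h₁ h₂
    have hgg : g a = g a' := by
      obtain ⟨hs, hxs⟩ := hmem _ (hg' _ ha)
      obtain ⟨ht, hxt⟩ := hmem _ (hg' _ ha')
      exact huniq _ x h₁.1 _ hs _ ht h₁.2 hxs (heq ▸ h₂.2) hxt
    obtain rfl := hg.injOn ha ha' hgg
    rw [hinj _ (hg' _ ha) heq]
  · intro y hy
    obtain ⟨f, hf, hyf, hxf⟩ := hex y x hy
    have hfF : f ∈ flowerAt B x := by simp [flowerAt, hf, hxf]
    obtain ⟨a, ha, rfl⟩ := hg.surjOn hfF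
    obtain ⟨c, hc⟩ := (hh _ hfF y).1 (Finset.mem_erase.2 ⟨hy, hyf⟩)
    exact ⟨(a, c), ha, hc⟩

lemma hasPairGDDTriple_of_mem_J3F {α : Type*} [DecidableEq α] {b : Finset α} {k : ℕ}
    (hk : k ∈ J3F b.card) : HasPairGDDTriple b k := by
  obtain ⟨B, C, F, x, hB, hC, hCk, hF, hr⟩ := mem_J3F_iff.1 hk
  obtain ⟨g, ψ, hg, hψ, hinj, hginj, hsurj⟩ :=
    exists_flower_labelling rfl (hB 0) (by rw [hF, hr])
  rw [hF 0] at hg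
  have hFB : ∀ i, ∀ f, f ∈ F ↔ f ∈ B i ∧ x ∈ f := fun i f => by simp [← hF i, flowerAt]
  set P : Finset (α × Bool) := b ×ˢ Finset.univ with hP
  have hmemP : ∀ p : α × Bool, p ∈ P ↔ p.1 ∈ b := by simp [hP]
  have hinjP : Set.InjOn ψ P := fun p hp q hq =>
    hinj p q ((hmemP p).1 hp) ((hmemP q).1 hq)
  have himage : ∀ s : Finset (Fin (2 * b.card + 1)), x ∉ s →
      (P.filter (ψ · ∈ s)).image ψ = s := by
    intro s hx
    ext y
    simp only [Finset.mem_image, Finset.mem_filter]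
    constructor
    · rintro ⟨p, ⟨-, hp⟩, rfl⟩; exact hp
    · intro hy
      obtain ⟨p, hp, rfl⟩ := hsurj y (by rintro rfl; exact hx hy)
      exact ⟨p, ⟨(hmemP p).2 hp, hy⟩, rfl⟩
  have hximage : ∀ t ⊆ P, x ∉ t.image ψ := by
    intro t ht hx
    obtain ⟨p, hp, hpx⟩ := Finset.mem_image.1 hx
    exact (hψ p ((hmemP p).1 (ht hp))).1 hpx
  have himinj : ∀ s ⊆ P, ∀ t ⊆ P, s.image ψ = t.image ψ → s = t := by
    intro s hs t ht hst
    have h := hinjP.image (Set.mem_powerset (Finset.coe_subset.2 hs))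
      (Set.mem_powerset (Finset.coe_subset.2 ht))
    exact Finset.coe_injective (h (by rw [← Finset.coe_image, hst, Finset.coe_image]))
  refine ⟨fun i => P.powerset.filter fun t => t.image ψ ∈ B i,
    P.powerset.filter fun t => t.image ψ ∈ C, fun i => ?_, fun i j hij => ?_, ?_⟩
  · obtain ⟨hB3, hex, huniq⟩ := isSTS_iff.1 (hB i)
    have hG : ∀ t, t ∈ P.powerset.filter (fun t => t.image ψ ∈ B i) ↔ t ⊆ P ∧ t.image ψ ∈ B i := by
      simp
    constructor
    · intro t ht
      obtain ⟨ht, htB⟩ := (hG t).1 ht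
      rw [← hB3 _ htB, Finset.card_image_of_injOn (hinjP.mono ht)]
    · intro t ht p hp
      exact (hmemP p).1 (((hG t).1 ht).1 hp)
    · intro t ht p hp q hq hpq
      obtain ⟨ht, htB⟩ := (hG t).1 ht
      by_contra hne
      have hpb := (hmemP p).1 (ht hp)
      have hqb := (hmemP q).1 (ht hq)
      obtain ⟨hgB, hxg⟩ := (hFB i _).1 (hg p.1 hpb)
      refine hximage t ht ?_
      rw [huniq (ψ p) (ψ q) (fun h => hne (hinj p q hpb hqb h)) _ htB _ hgB
        (Finset.mem_image_of_mem _ hp) (Finset.mem_image_of_mem _ hq)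
        (hψ p hpb).2 (hpq ▸ (hψ q hqb).2)]
      exact hxg
    · intro p q hp hq hpq
      obtain ⟨s, hs, hps, hqs⟩ := hex (ψ p) (ψ q)
        (fun h => hpq (congrArg Prod.fst (hinj p q hp hq h)))
      have hflower : ∀ a : α × Bool, a.1 ∈ b → ψ a ∈ s → x ∈ s → s = g a.1 := by
        intro a ha has hxs
        obtain ⟨hgB, hxg⟩ := (hFB i _).1 (hg a.1 ha)
        exact huniq _ x (hψ a ha).1 _ hs _ hgB has hxs (hψ a ha).2 hxg
      have hxs : x ∉ s := fun hxs =>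
        hpq (hginj hp hq ((hflower p hp hps hxs).symm.trans (hflower q hq hqs hxs)))
      refine ⟨P.filter (ψ · ∈ s), (hG _).2 ⟨Finset.filter_subset _ _, ?_⟩, ?_, ?_⟩
      · rwa [himage s hxs]
      · simp [hmemP, hp, hps]
      · simp [hmemP, hq, hqs]
    · intro p q hpq s hs t ht hps hqs hpt hqt
      obtain ⟨hs, hsB⟩ := (hG s).1 hs
      obtain ⟨ht, htB⟩ := (hG t).1 ht
      exact himinj s hs t ht (huniq (ψ p) (ψ q)
        (fun h => hpq (hinjP (hs hps) (hs hqs) h)) _ hsB _ htB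
        (Finset.mem_image_of_mem _ hps) (Finset.mem_image_of_mem _ hqs)
        (Finset.mem_image_of_mem _ hpt) (Finset.mem_image_of_mem _ hqt))
  · rw [← hC i j hij]
    ext t
    simp only [Finset.mem_inter, Finset.mem_filter]
    tauto
  · have hFC : F ⊆ C := by
      intro f hf
      rw [← hC 0 1 (by decide)]
      exact Finset.mem_inter.2 ⟨((hFB 0 f).1 hf).1, ((hFB 1 f).1 hf).1⟩
    have hsdiff : (C \ F).card = k := by
      rw [Finset.card_sdiff_of_subset hFC, hCk, hr, Nat.add_sub_cancel]
    have hCF : ∀ s, s ∈ C \ F ↔ s ∈ C ∧ x ∉ s := by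
      intro s
      have hCB : s ∈ C → s ∈ B 0 := fun h => by
        rw [← hC 0 1 (by decide)] at h
        exact (Finset.mem_inter.1 h).1
      rw [Finset.mem_sdiff, hFB 0]
      tauto
    rw [← hsdiff]
    refine Finset.card_bij (fun t _ => t.image ψ) ?_ ?_ ?_
    · intro t ht
      simp only [Finset.mem_filter, Finset.mem_powerset] at ht
      exact (hCF _).2 ⟨ht.2, hximage t ht.1⟩
    · intro s hs t ht
      simp only [Finset.mem_filter, Finset.mem_powerset] at hs ht
      exact himinj s hs.1 t ht.1
    · intro s hs
      obtain ⟨hsC, hxs⟩ := (hCF s).1 hs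
      exact ⟨P.filter (ψ · ∈ s), by simp [himage s hxs, hsC], himage s hxs⟩

lemma mem_J3F_of_hasPairGDDTriple {r k : ℕ}
    (h : HasPairGDDTriple (Finset.univ : Finset (Fin r)) k) : k ∈ J3F r := by
  obtain ⟨G, C, hG, hC, hk⟩ := h
  have e : Option (Fin r × Bool) ≃ Fin (2 * r + 1) :=
    Fintype.equivOfCardEq (by simp [mul_comm])
  obtain ⟨x, ψ, hinj, hx, hsurj⟩ : ∃ (x : Fin (2 * r + 1)) (ψ : Fin r × Bool → Fin (2 * r + 1)),
      Function.Injective ψ ∧ (∀ p, ψ p ≠ x) ∧ ∀ y, y = x ∨ ∃ p, ψ p = y := by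
    refine ⟨e none, fun p => e (some p), fun p q h => by simpa using h, by simp, fun y => ?_⟩
    obtain ⟨o, rfl⟩ := e.surjective y
    cases o <;> simp
  set fl : Fin r → Finset (Fin (2 * r + 1)) := fun a => {x, ψ (a, false), ψ (a, true)} with hfl
  have hxfl : ∀ a, x ∈ fl a := by simp [hfl]
  have hψfl : ∀ p a, ψ p ∈ fl a ↔ p.1 = a := by
    rintro ⟨a, c⟩ a'
    simp only [hfl, Finset.mem_insert, Finset.mem_singleton, hx, hinj.eq_iff, Prod.mk.injEq]
    cases c <;> simp
  have hflinj : Function.Injective fl := fun a a' haa => by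
    have := (hψfl (a, true) a).2 rfl
    rw [haa] at this
    exact (hψfl _ _).1 this
  have hximage : ∀ t : Finset (Fin r × Bool), x ∉ t.image ψ := by simp [hx]
  have himinj : Function.Injective (Finset.image ψ) := Finset.image_injective hinj
  have hflimage : ∀ a (t : Finset (Fin r × Bool)), fl a ≠ t.image ψ :=
    fun a t h => hximage t (h ▸ hxfl a)
  set S : Finset (Finset (Fin r × Bool)) → Finset (Finset (Fin (2 * r + 1))) :=
    fun D => Finset.univ.image fl ∪ D.image (Finset.image ψ) with hS
  have hmemS : ∀ D s, s ∈ S D ↔ (∃ a, fl a = s) ∨ ∃ t ∈ D, t.image ψ = s := by simp [hS]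
  have hdisj : ∀ D : Finset (Finset (Fin r × Bool)),
      Disjoint (Finset.univ.image fl) (D.image (Finset.image ψ)) := by
    intro D
    rw [Finset.disjoint_left]
    simp only [Finset.mem_image, Finset.mem_univ, true_and]
    rintro _ ⟨a, rfl⟩ ⟨t, -, h⟩
    exact hflimage a t h.symm
  have hflcard : (Finset.univ.image fl).card = r := by
    rw [Finset.card_image_of_injective _ hflinj, Finset.card_univ, Fintype.card_fin]
  refine mem_J3F_iff.2 ⟨fun i => S (G i), S C, Finset.univ.image fl, x, fun i => ?_,
    fun i j hij => ?_, ?_, fun i => ?_, hflcard⟩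
  · rw [isSTS_iff]
    refine ⟨fun s hs => ?_, fun y z hyz => ?_, fun y z hyz s hs t ht hys hzs hyt hzt => ?_⟩
    · obtain ⟨a, rfl⟩ | ⟨t, ht, rfl⟩ := (hmemS _ _).1 hs
      · exact Finset.card_eq_three.2 ⟨_, _, _, (hx _).symm, (hx _).symm,
          hinj.ne (by simp), rfl⟩
      · rw [Finset.card_image_of_injective _ hinj, (hG i).card_eq t ht]
    · obtain rfl | ⟨p, rfl⟩ := hsurj y <;> obtain rfl | ⟨q, rfl⟩ := hsurj z
      · exact absurd rfl hyz
      · exact ⟨fl q.1, (hmemS _ _).2 (Or.inl ⟨_, rfl⟩), hxfl _, (hψfl _ _).2 rfl⟩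
      · exact ⟨fl p.1, (hmemS _ _).2 (Or.inl ⟨_, rfl⟩), (hψfl _ _).2 rfl, hxfl _⟩
      · by_cases hpq : p.1 = q.1
        · exact ⟨fl p.1, (hmemS _ _).2 (Or.inl ⟨_, rfl⟩), (hψfl _ _).2 rfl,
            (hψfl _ _).2 hpq.symm⟩
        · obtain ⟨t, ht, hp, hq⟩ := (hG i).exists_mem p q (by simp) (by simp) hpq
          exact ⟨_, (hmemS _ _).2 (Or.inr ⟨t, ht, rfl⟩), Finset.mem_image_of_mem _ hp,
            Finset.mem_image_of_mem _ hq⟩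
    · have hmixed : ∀ a, ∀ t ∈ G i, y ∈ fl a → z ∈ fl a → y ∈ t.image ψ → z ∈ t.image ψ →
          False := by
        intro a t ht hya hza hyt hzt
        obtain ⟨p, hp, rfl⟩ := Finset.mem_image.1 hyt
        obtain ⟨q, hq, rfl⟩ := Finset.mem_image.1 hzt
        exact hyz (congrArg ψ ((hG i).fst_injOn t ht p hp q hq
          (((hψfl _ _).1 hya).trans ((hψfl _ _).1 hza).symm)))
      obtain ⟨a, rfl⟩ | ⟨s, hsG, rfl⟩ := (hmemS _ _).1 hs <;>
        obtain ⟨a', rfl⟩ | ⟨t, htG, rfl⟩ := (hmemS _ _).1 ht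
      · obtain rfl | ⟨p, rfl⟩ := hsurj y
        · obtain rfl | ⟨q, rfl⟩ := hsurj z
          · exact absurd rfl hyz
          · rw [← (hψfl _ _).1 hzs, ← (hψfl _ _).1 hzt]
        · rw [← (hψfl _ _).1 hys, ← (hψfl _ _).1 hyt]
      · exact (hmixed a t htG hys hzs hyt hzt).elim
      · exact (hmixed a' s hsG hyt hzt hys hzs).elim
      · obtain ⟨p, hp, rfl⟩ := Finset.mem_image.1 hys
        obtain ⟨q, hq, rfl⟩ := Finset.mem_image.1 hzs
        rw [hinj.mem_finset_image] at hyt hzt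
        rw [(hG i).unique p q (fun h => hyz (congrArg ψ h)) s hsG t htG hp hq hyt hzt]
  · rw [← hC i j hij]
    simp only [hS]
    rw [← Finset.union_inter_distrib_left, Finset.image_inter _ _ himinj]
  · simp only [hS]
    rw [Finset.card_union_of_disjoint (hdisj C), hflcard,
      Finset.card_image_of_injective _ himinj, hk, add_comm]
  · ext s
    simp only [flowerAt, Finset.mem_filter, hmemS, Finset.mem_image, Finset.mem_univ, true_and]
    constructor
    · rintro ⟨h | ⟨t, -, rfl⟩, hxs⟩
      · exact h
      · exact absurd hxs (hximage t)
    · rintro ⟨a, rfl⟩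
      exact ⟨Or.inl ⟨a, rfl⟩, hxfl a⟩

/-- Designs on the blocks of a linear space that covers `univ` glue to a design on `univ`. -/
lemma HasPairGDDTriple.biUnion {α : Type*} [Fintype α] [DecidableEq α]
    {𝓑 : Finset (Finset α)} {k : Finset α → ℕ}
    (hex : ∀ x y : α, x ≠ y → ∃ b ∈ 𝓑, x ∈ b ∧ y ∈ b)
    (huniq : ∀ x y : α, x ≠ y →
      ∀ b ∈ 𝓑, ∀ c ∈ 𝓑, x ∈ b → y ∈ b → x ∈ c → y ∈ c → b = c)
    (h : ∀ b ∈ 𝓑, HasPairGDDTriple b (k b)) :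
    HasPairGDDTriple (Finset.univ : Finset α) (∑ b ∈ 𝓑, k b) := by
  choose! G C hG hC hk using h
  have hblock : ∀ b ∈ 𝓑, ∀ c ∈ 𝓑, ∀ i, ∀ t ∈ G b i, ∀ p ∈ t, ∀ q ∈ t, p ≠ q →
      p.1 ∈ c → q.1 ∈ c → b = c := by
    intro b hb c hc i t ht p hp q hq hpq hpc hqc
    exact huniq p.1 q.1 (fun h => hpq ((hG b hb i).fst_injOn t ht p hp q hq h)) b hb c hc
      ((hG b hb i).fst_mem t ht p hp) ((hG b hb i).fst_mem t ht q hq) hpc hqc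
  have hshared : ∀ b ∈ 𝓑, ∀ c ∈ 𝓑, ∀ i j, ∀ t, t ∈ G b i → t ∈ G c j → b = c := by
    intro b hb c hc i j t ht ht'
    obtain ⟨p, hp, q, hq, hpq⟩ := Finset.one_lt_card.1
      (by rw [(hG b hb i).card_eq t ht]; norm_num : 1 < t.card)
    exact hblock b hb c hc i t ht p hp q hq hpq
      ((hG c hc j).fst_mem t ht' p hp) ((hG c hc j).fst_mem t ht' q hq)
  have hCG : ∀ b ∈ 𝓑, ∀ t ∈ C b, t ∈ G b 0 := by
    intro b hb t ht
    rw [← hC b hb 0 1 (by decide)] at ht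
    exact (Finset.mem_inter.1 ht).1
  refine ⟨fun i => 𝓑.biUnion (G · i), 𝓑.biUnion C, fun i => ?_, fun i j hij => ?_, ?_⟩
  · constructor
    · intro t ht
      obtain ⟨b, hb, ht⟩ := Finset.mem_biUnion.1 ht
      exact (hG b hb i).card_eq t ht
    · simp
    · intro t ht
      obtain ⟨b, hb, ht⟩ := Finset.mem_biUnion.1 ht
      exact (hG b hb i).fst_injOn t ht
    · intro p q _ _ hpq
      obtain ⟨b, hb, hp, hq⟩ := hex p.1 q.1 hpq
      obtain ⟨t, ht, hpt, hqt⟩ := (hG b hb i).exists_mem p q hp hq hpq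
      exact ⟨t, Finset.mem_biUnion.2 ⟨b, hb, ht⟩, hpt, hqt⟩
    · intro p q hpq s hs t ht hps hqs hpt hqt
      obtain ⟨b, hb, hs⟩ := Finset.mem_biUnion.1 hs
      obtain ⟨c, hc, ht⟩ := Finset.mem_biUnion.1 ht
      obtain rfl := hblock b hb c hc i s hs p hps q hqs hpq
        ((hG c hc i).fst_mem t ht p hpt) ((hG c hc i).fst_mem t ht q hqt)
      exact (hG b hb i).unique p q hpq s hs t ht hps hqs hpt hqt
  · ext t
    simp only [Finset.mem_inter, Finset.mem_biUnion]
    constructor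
    · rintro ⟨⟨b, hb, ht⟩, c, hc, ht'⟩
      obtain rfl := hshared b hb c hc i j t ht ht'
      exact ⟨b, hb, hC b hb i j hij ▸ Finset.mem_inter.2 ⟨ht, ht'⟩⟩
    · rintro ⟨b, hb, ht⟩
      rw [← hC b hb i j hij, Finset.mem_inter] at ht
      exact ⟨⟨b, hb, ht.1⟩, b, hb, ht.2⟩
  · rw [Finset.card_biUnion, Finset.sum_congr rfl hk]
    intro b hb c hc hbc
    refine Finset.disjoint_left.2 ?_
    exact fun t ht ht' => hbc (hshared b hb c hc 0 0 t (hCG b hb t ht) (hCG c hc t ht'))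

/-- Let every element of `K` be `≡ 0, 1 (mod 3)` and `r ≡ 0, 1 (mod 3)`.
If `(X, 𝓑)` is a `B(K, 1, r)` and for each block `B ∈ 𝓑` an integer `k_B ∈ J³_F(|B|)`
is chosen, then `∑_{B ∈ 𝓑} k_B ∈ J³_F(r)`. -/
theorem stmt9 (K : Set ℕ) (hK : ∀ m ∈ K, m % 3 = 0 ∨ m % 3 = 1)
    (r : ℕ) (hr : r % 3 = 0 ∨ r % 3 = 1)
    (𝓑 : Finset (Finset (Fin r))) (hPBD : IsPBD r K 𝓑)
    (kB : Finset (Fin r) → ℕ) (hkB : ∀ B ∈ 𝓑, kB B ∈ J3F B.card) :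
    (∑ B ∈ 𝓑, kB B) ∈ J3F r := by
  refine mem_J3F_of_hasPairGDDTriple (HasPairGDDTriple.biUnion (fun x y hxy => ?_)
    (fun x y hxy b hb c hc h₁ h₂ h₃ h₄ => ?_) fun B hB => hasPairGDDTriple_of_mem_J3F (hkB B hB))
  · obtain ⟨b, ⟨hb, hp⟩, -⟩ := hPBD.2 {x, y} (Finset.card_pair hxy)
    exact ⟨b, hb, hp (by simp), hp (by simp)⟩
  · refine (hPBD.2 {x, y} (Finset.card_pair hxy)).unique ⟨hb, ?_⟩ ⟨hc, ?_⟩ <;>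
      simp [Finset.insert_subset_iff, *]
end
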